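/- arXiv:1506.04306 — 3 statements merged into one kernel-verified Lean document; each statement's English description precedes it below -/
import Mathlib

section
/- Let p be an irreducible and aperiodic stochastic matrix on a countable set S admitting a stationary distribution π. Suppose p satisfies the weighted spectral gap condition with data (t, B, ρ), where the finite set B is nonempty, and suppose moreover that Σ_{j∈S} p(i,j)·t_j < ∞ for every i ∈ B. Then there exist θ ∈ (0,1) and, for every pair (i,j) ∈ S×S, a constant Ĉ_{ij} > 0, such that |p^{(n)}_{ij} − π_j| ≤ Ĉ_{ij}·θ^n for all n ≥ 1. (Markov-chain form of the paper's main exponential mixing theorem, Theorem 4.5.) -/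
open scoped Classical

/-- Taboo probabilities: `tabooP p B n i j` is the probability of going from `i` to `j`
in `n` steps while all intermediate states avoid the taboo set `B`. -/
noncomputable def tabooP {S : Type*} (p : S → S → ℝ) (B : Set S) : ℕ → S → S → ℝ
  | 0 => fun i j => if i = j then 1 else 0
  | 1 => fun i j => p i j
  | n + 2 => fun i j => ∑' r : ↥Bᶜ, p i (r : S) * tabooP p B (n + 1) (r : S) j

/-- `n`-step transition probabilities. -/
noncomputable def nstep {S : Type*} (p : S → S → ℝ) : ℕ → S → S → ℝ :=
  tabooP p (∅ : Set S)

open Filter Topology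

structure IsStochastic {S : Type*} (q : S → S → ℝ) : Prop where
  nonneg : ∀ i j, 0 ≤ q i j
  hasSum : ∀ i, HasSum (q i) 1

lemma hasSum_comp_of_nonneg {S : Type*} {w w' : S → ℝ} {q : S → S → ℝ} {f g : S → ℝ} {s : ℝ}
    (hw : ∀ v, 0 ≤ w v) (hq : ∀ v u, 0 ≤ q v u) (hf : ∀ u, 0 ≤ f u)
    (hg : ∀ v, HasSum (fun u => q v u * f u) (g v)) (hs : HasSum (fun v => w v * g v) s)
    (hw' : ∀ u, HasSum (fun v => w v * q v u) (w' u)) :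
    HasSum (fun u => w' u * f u) s := by
  have hrow : ∀ v, HasSum (fun u => w v * q v u * f u) (w v * g v) := fun v => by
    simpa only [mul_assoc] using (hg v).mul_left (w v)
  have hsum : Summable fun x : S × S => w x.1 * q x.1 x.2 * f x.2 := by
    refine (summable_prod_of_nonneg
      fun x => mul_nonneg (mul_nonneg (hw _) (hq _ _)) (hf _)).2 ⟨fun v => (hrow v).summable, ?_⟩
    simpa only [(hrow _).tsum_eq] using hs.summable
  have htot : HasSum (fun x : S × S => w x.1 * q x.1 x.2 * f x.2) s := by
    have h := hsum.hasSum
    rwa [(h.prod_fiberwise hrow).unique hs] at h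
  have hswap : HasSum (fun x : S × S => w x.2 * q x.2 x.1 * f x.1) s :=
    (Equiv.prodComm S S).hasSum_iff.2 htot
  exact hswap.prod_fiberwise fun u => (hw' u).mul_right (f u)

namespace IsStochastic

variable {S : Type*} {q : S → S → ℝ}

lemma le_one (hq : IsStochastic q) (i j : S) : q i j ≤ 1 :=
  le_hasSum (hq.hasSum i) j fun k _ => hq.nonneg i k

lemma summable_mul (hq : IsStochastic q) {f : S → ℝ} (hf₀ : ∀ u, 0 ≤ f u) (hf₁ : ∀ u, f u ≤ 1)
    (i : S) : Summable fun u => q i u * f u :=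
  (hq.hasSum i).summable.of_nonneg_of_le (fun u => mul_nonneg (hq.nonneg i u) (hf₀ u))
    fun u => mul_le_of_le_one_right (hq.nonneg i u) (hf₁ u)

lemma hasSum_const (hq : IsStochastic q) (c : ℝ) (i : S) : HasSum (fun u => q i u * c) c := by
  simpa using (hq.hasSum i).mul_right c

lemma tsum_mul_mem (hq : IsStochastic q) {f : S → ℝ} (hf₀ : ∀ u, 0 ≤ f u) (hf₁ : ∀ u, f u ≤ 1)
    (i : S) : 0 ≤ ∑' u, q i u * f u ∧ ∑' u, q i u * f u ≤ 1 :=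
  ⟨tsum_nonneg fun u => mul_nonneg (hq.nonneg i u) (hf₀ u),
    hasSum_le (fun u => mul_le_of_le_one_right (hq.nonneg i u) (hf₁ u))
      (hq.summable_mul hf₀ hf₁ i).hasSum (hq.hasSum i)⟩

lemma hasSum_le_affine (hq : IsStochastic q) {t f : S → ℝ} {T F c d e : ℝ} {x b : S}
    (hT : HasSum (fun u => q x u * t u) T) (hF : HasSum (fun u => q x u * f u) F)
    (hle : ∀ u, f u ≤ c + d * t u - if u = b then e else 0) :
    F ≤ c + d * T - q x b * e := by
  have h₁ : HasSum (fun u => q x u * if u = b then e else 0) (q x b * e) := by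
    convert hasSum_single b ?_ using 1
    · simp
    · intro u hu
      simp [hu]
  refine hasSum_le (fun u => ?_) hF (((hq.hasSum_const c x).add (hT.mul_left d)).sub h₁)
  have := mul_le_mul_of_nonneg_left (hle u) (hq.nonneg x u)
  linarith

/-- Independent coupling: two copies of the chain started at `x` and `y` meet at `b` with
probability at least `q x b * q y b`, which improves the trivial bound on the difference. -/
lemma sub_le_of_coupling (hq : IsStochastic q) {t f : S → ℝ} (ht : ∀ i, 0 ≤ t i)
    {A β T T' F F' : ℝ} (hA : 0 ≤ A) (hβ : 0 ≤ β) {x y : S} (b : S)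
    (hT : HasSum (fun u => q x u * t u) T) (hT' : HasSum (fun u => q y u * t u) T')
    (hF : HasSum (fun u => q x u * f u) F) (hF' : HasSum (fun u => q y u * f u) F')
    (hf : ∀ u v, f u - f v ≤ A * (2 + β * t u + β * t v)) :
    F - F' ≤ A * (2 + β * T + β * T') - q x b * q y b * (2 * A) := by
  have key : ∀ u, f u ≤ (F' + A * 2 + A * β * T') + A * β * t u -
      if u = b then q y b * (2 * A) else 0 := by
    intro u
    have := hq.hasSum_le_affine (f := fun v => -f v) (F := -F') (c := A * (2 + β * t u) - f u)
      (d := A * β) (e := if u = b then 2 * A else 0) (b := b) hT' (by simpa using hF'.neg) ?_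
    · split_ifs at this ⊢ <;> linarith
    · intro v
      have h := hf u v
      split_ifs with hv hu
      · subst hv hu
        have := mul_nonneg hA (mul_nonneg hβ (ht u))
        linarith
      all_goals linarith
  have := hq.hasSum_le_affine hT hF key
  linarith

lemma abs_sub_le_of_drift_of_minorization (hq : IsStochastic q) {t : S → ℝ} (ht : ∀ i, 0 ≤ t i)
    {ρ K R ε β α : ℝ} (hρ₁ : ρ < 1) (hR : R = 8 * (K + 1) / (1 - ρ))
    (hε : 0 < ε) (hβ : 0 < β) (hβK : β * K ≤ ε ^ 2 / 2)
    (hα₁ : (1 + ρ) / 2 ≤ α) (hα₂ : 1 - β ≤ α) (hα₃ : 1 - ε ^ 2 / 2 ≤ α)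
    (hts : ∀ i, Summable fun u => q i u * t u)
    (hdrift : ∀ i, ∑' u, q i u * t u ≤ ρ * t i + K)
    {b : S} (hmin : ∀ i, t i ≤ R → ε ≤ q i b)
    {A : ℝ} (hA : 0 ≤ A) {f g : S → ℝ} (hfg : ∀ i, HasSum (fun u => q i u * f u) (g i))
    (hf : ∀ u v, |f u - f v| ≤ A * (2 + β * t u + β * t v)) (x y : S) :
    |g x - g y| ≤ A * α * (2 + β * t x + β * t y) := by
  wlog hxy : g y ≤ g x generalizing x y
  · rw [abs_sub_comm]
    convert this y x (le_of_not_ge hxy) using 2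
    ring
  rw [abs_of_nonneg (sub_nonneg.2 hxy)]
  have h := hq.sub_le_of_coupling ht hA hβ.le b (hts x).hasSum (hts y).hasSum (hfg x) (hfg y)
    fun u v => (le_abs_self _).trans (hf u v)
  have hdx := mul_le_mul_of_nonneg_left (hdrift x) hβ.le
  have hdy := mul_le_mul_of_nonneg_left (hdrift y) hβ.le
  have hx := ht x
  have hy := ht y
  suffices H : 2 + β * (ρ * t x + K) + β * (ρ * t y + K) - q x b * q y b * 2 ≤
      α * (2 + β * t x + β * t y) by
    have h₁ : 2 + β * (∑' u, q x u * t u) + β * (∑' u, q y u * t u) - q x b * q y b * 2 ≤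
      α * (2 + β * t x + β * t y) := by linarith
    have := mul_le_mul_of_nonneg_left h₁ hA
    linarith
  have hs : 0 ≤ β * (t x + t y) := mul_nonneg hβ.le (add_nonneg hx hy)
  by_cases hcase : t x ≤ R ∧ t y ≤ R
  · have hqq : ε * ε ≤ q x b * q y b :=
      mul_le_mul (hmin x hcase.1) (hmin y hcase.2) hε.le (hq.nonneg x b)
    have h₁ : ρ * (β * (t x + t y)) ≤ α * (β * (t x + t y)) :=
      mul_le_mul_of_nonneg_right (by linarith) hs
    nlinarith
  · have hsR : R ≤ t x + t y := by
      rw [not_and_or, not_le, not_le] at hcase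
      rcases hcase with h | h <;> linarith
    rw [hR, div_le_iff₀ (by linarith)] at hsR
    have hqq : 0 ≤ q x b * q y b := mul_nonneg (hq.nonneg x b) (hq.nonneg y b)
    have h₁ : (1 + ρ) / 2 * (β * (t x + t y)) ≤ α * (β * (t x + t y)) :=
      mul_le_mul_of_nonneg_right hα₁ hs
    have h₂ := mul_le_mul_of_nonneg_left hsR hβ.le
    nlinarith

end IsStochastic

lemma nstep_zero {S : Type*} (p : S → S → ℝ) (i j : S) :
    nstep p 0 i j = if i = j then 1 else 0 := rfl

lemma nstep_succ {S : Type*} (p : S → S → ℝ) (n : ℕ) (i j : S) :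
    nstep p (n + 1) i j = ∑' r, p i r * nstep p n r j := by
  cases n with
  | zero =>
    rw [tsum_eq_single j fun r hr => by simp [nstep_zero, hr]]
    simp [nstep, tabooP]
  | succ n =>
    exact (Function.Injective.tsum_eq (f := fun r => p i r * nstep p (n + 1) r j)
      (g := ((↑) : ↥((∅ : Set S)ᶜ) → S)) Subtype.val_injective (by simp))

namespace IsStochastic

variable {S : Type*} {p : S → S → ℝ}

lemma nstep_isStochastic (hp : IsStochastic p) (n : ℕ) : IsStochastic (nstep p n) := by
  induction n with
  | zero =>
    refine ⟨fun i j => ?_, fun i => ?_⟩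
    · rw [nstep_zero]
      split_ifs <;> norm_num
    · convert hasSum_single i ?_ using 1
      · simp [nstep_zero]
      · intro j hj
        simp [nstep_zero, hj.symm]
  | succ n ih =>
    refine ⟨fun i j => ?_, fun i => ?_⟩
    · rw [nstep_succ]
      exact tsum_nonneg fun r => mul_nonneg (hp.nonneg i r) (ih.nonneg r j)
    · simpa using hasSum_comp_of_nonneg (f := fun _ => 1) (g := fun _ => 1) (hp.nonneg i) ih.nonneg
        (fun _ => zero_le_one) (fun v => by simpa using ih.hasSum v) (by simpa using hp.hasSum i)
        (fun u => by
          rw [nstep_succ]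
          exact (hp.summable_mul (fun r => ih.nonneg r u) (fun r => ih.le_one r u) i).hasSum)

lemma hasSum_nstep_succ (hp : IsStochastic p) (n : ℕ) (i j : S) :
    HasSum (fun r => p i r * nstep p n r j) (nstep p (n + 1) i j) := by
  rw [nstep_succ]
  exact (hp.summable_mul (fun r => (hp.nstep_isStochastic n).nonneg r j)
    (fun r => (hp.nstep_isStochastic n).le_one r j) i).hasSum

lemma hasSum_nstep_zero (f : S → ℝ) (i : S) :
    HasSum (fun u => nstep p 0 i u * f u) (f i) := by
  convert hasSum_single i ?_ using 1
  · simp [nstep_zero]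
  · intro j hj
    simp [nstep_zero, hj.symm]

lemma hasSum_nstep_add (hp : IsStochastic p) (m n : ℕ) (i j : S) :
    HasSum (fun u => nstep p m i u * nstep p n u j) (nstep p (m + n) i j) := by
  induction m generalizing i with
  | zero => simpa using hasSum_nstep_zero (p := p) (fun u => nstep p n u j) i
  | succ m ih =>
    rw [add_right_comm]
    exact hasSum_comp_of_nonneg (hp.nonneg i) (hp.nstep_isStochastic m).nonneg
      (fun u => (hp.nstep_isStochastic n).nonneg u j) ih (hp.hasSum_nstep_succ (m + n) i j)
      (hp.hasSum_nstep_succ m i)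

lemma nstep_mul_le (hp : IsStochastic p) (m n : ℕ) (i k j : S) :
    nstep p m i k * nstep p n k j ≤ nstep p (m + n) i j :=
  le_hasSum (hp.hasSum_nstep_add m n i j) k
    fun u _ => mul_nonneg ((hp.nstep_isStochastic m).nonneg i u) ((hp.nstep_isStochastic n).nonneg u j)

lemma nstep_drift (hp : IsStochastic p) {t : S → ℝ} (ht : ∀ i, 0 ≤ t i) {ρ K : ℝ} (hρ : 0 ≤ ρ)
    (hts : ∀ i, Summable fun u => p i u * t u)
    (hdrift : ∀ i, ∑' u, p i u * t u ≤ ρ * t i + K * (1 - ρ)) (n : ℕ) (i : S) :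
    ∃ T, HasSum (fun u => nstep p n i u * t u) T ∧ T ≤ ρ ^ n * t i + K * (1 - ρ ^ n) := by
  induction n generalizing i with
  | zero => exact ⟨t i, hasSum_nstep_zero t i, by simp⟩
  | succ n ih =>
    choose g hg hgle using ih
    have hg₀ : ∀ v, 0 ≤ g v := fun v =>
      (hg v).nonneg fun u => mul_nonneg ((hp.nstep_isStochastic n).nonneg v u) (ht u)
    have hub : HasSum (fun u => p i u * (ρ ^ n * t u + K * (1 - ρ ^ n)))
        (ρ ^ n * (∑' u, p i u * t u) + K * (1 - ρ ^ n)) := by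
      have h := ((hts i).hasSum.mul_left (ρ ^ n)).add (hp.hasSum_const (K * (1 - ρ ^ n)) i)
      refine h.congr_fun fun u => ?_
      ring
    have hle : ∀ u, p i u * g u ≤ p i u * (ρ ^ n * t u + K * (1 - ρ ^ n)) := fun u =>
      mul_le_mul_of_nonneg_left (hgle u) (hp.nonneg i u)
    have hs : Summable fun u => p i u * g u :=
      hub.summable.of_nonneg_of_le (fun u => mul_nonneg (hp.nonneg i u) (hg₀ u)) hle
    refine ⟨_, hasSum_comp_of_nonneg (hp.nonneg i) (hp.nstep_isStochastic n).nonneg ht hg hs.hasSum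
      (hp.hasSum_nstep_succ n i), (hasSum_le hle hs.hasSum hub).trans ?_⟩
    have := mul_le_mul_of_nonneg_left (hdrift i) (pow_nonneg hρ n)
    rw [pow_succ]
    linarith

end IsStochastic

/-- The probability that the chain started at `i` avoids `B` at all times `0, …, n`. -/
noncomputable def survival {S : Type*} (p : S → S → ℝ) (B : Set S) : ℕ → S → ℝ
  | 0 => fun i => if i ∈ B then 0 else 1
  | n + 1 => fun i => if i ∈ B then 0 else ∑' j, p i j * survival p B n j

lemma survival_of_mem {S : Type*} (p : S → S → ℝ) {B : Set S} {i : S} (hi : i ∈ B) (n : ℕ) :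
    survival p B n i = 0 := by
  cases n <;> simp [survival, hi]

lemma survival_zero_of_notMem {S : Type*} (p : S → S → ℝ) {B : Set S} {i : S} (hi : i ∉ B) :
    survival p B 0 i = 1 := by
  simp [survival, hi]

namespace IsStochastic

variable {S : Type*} {p : S → S → ℝ} {B : Set S}

lemma survival_mem_Icc (hp : IsStochastic p) (n : ℕ) (i : S) :
    0 ≤ survival p B n i ∧ survival p B n i ≤ 1 := by
  induction n generalizing i with
  | zero => simp only [survival]; split_ifs <;> norm_num
  | succ n ih =>
    simp only [survival]
    split_ifs
    · norm_num
    · exact hp.tsum_mul_mem (fun u => (ih u).1) (fun u => (ih u).2) i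

lemma hasSum_survival_succ (hp : IsStochastic p) {i : S} (hi : i ∉ B) (n : ℕ) :
    HasSum (fun j => p i j * survival p B n j) (survival p B (n + 1) i) := by
  simp only [survival, if_neg hi]
  exact (hp.summable_mul (fun u => (hp.survival_mem_Icc n u).1)
    (fun u => (hp.survival_mem_Icc n u).2) i).hasSum

lemma antitone_survival (hp : IsStochastic p) (i : S) : Antitone fun n => survival p B n i := by
  refine antitone_nat_of_succ_le fun n => ?_
  induction n generalizing i with
  | zero =>
    by_cases hi : i ∈ B
    · simp [survival_of_mem p hi]
    · rw [survival_zero_of_notMem p hi]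
      exact (hp.survival_mem_Icc _ i).2
  | succ n ih =>
    by_cases hi : i ∈ B
    · simp [survival_of_mem p hi]
    · exact hasSum_le (fun j => mul_le_mul_of_nonneg_left (ih j) (hp.nonneg i j))
        (hp.hasSum_survival_succ hi (n + 1)) (hp.hasSum_survival_succ hi n)

lemma survival_sub_succ_le (hp : IsStochastic p) {t : S → ℝ} (ht : ∀ i, 0 ≤ t i) {ρ c : ℝ}
    (hρ : 0 ≤ ρ) (hc : 0 < c) (htB : ∀ i ∈ B, c ≤ t i) (hts : ∀ i, Summable fun u => p i u * t u)
    (hgap : ∀ i ∉ B, ∑' j, p i j * t j ≤ ρ * t i) (n : ℕ) (i : S) :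
    survival p B n i - survival p B (n + 1) i ≤ ρ ^ (n + 1) * t i / c := by
  have hbound : ∀ (n : ℕ) (i : S), 0 ≤ ρ ^ n * t i / c := fun n i =>
    div_nonneg (mul_nonneg (pow_nonneg hρ n) (ht i)) hc.le
  have hstep : ∀ {i}, i ∉ B → ∀ (n : ℕ) (f : S → ℝ) (F : ℝ), HasSum (fun j => p i j * f j) F →
      (∀ j, f j ≤ ρ ^ n * t j / c) → F ≤ ρ ^ (n + 1) * t i / c := by
    intro i hi n f F hF hf
    have hT : HasSum (fun j => p i j * (ρ ^ n * t j / c)) (ρ ^ n / c * ∑' j, p i j * t j) :=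
      ((hts i).hasSum.mul_left (ρ ^ n / c)).congr_fun fun j => by ring
    refine (hasSum_le (fun j => mul_le_mul_of_nonneg_left (hf j) (hp.nonneg i j)) hF hT).trans ?_
    refine (mul_le_mul_of_nonneg_left (hgap i hi) (div_nonneg (pow_nonneg hρ n) hc.le)).trans_eq ?_
    ring
  induction n generalizing i with
  | zero =>
    by_cases hi : i ∈ B
    · simpa [survival_of_mem p hi] using hbound 1 i
    · rw [survival_zero_of_notMem p hi]
      refine hstep hi 0 (fun j => 1 - survival p B 0 j) _
        (((hp.hasSum i).sub (hp.hasSum_survival_succ hi 0)).congr_fun fun j => by ring) fun j => ?_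
      by_cases hj : j ∈ B
      · simpa [survival_of_mem p hj, one_le_div hc] using htB j hj
      · simpa [survival_zero_of_notMem p hj] using hbound 0 j
  | succ n ih =>
    by_cases hi : i ∈ B
    · simpa [survival_of_mem p hi] using hbound (n + 2) i
    · exact hstep hi (n + 1) (fun j => survival p B n j - survival p B (n + 1) j) _
        (((hp.hasSum_survival_succ hi n).sub (hp.hasSum_survival_succ hi (n + 1))).congr_fun
          fun j => by ring) ih

lemma survival_le_of_tendsto_zero (hp : IsStochastic p) {t : S → ℝ} (ht : ∀ i, 0 ≤ t i) {ρ c : ℝ}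
    (hρ : 0 ≤ ρ) (hρ₁ : ρ < 1) (hc : 0 < c) (htB : ∀ i ∈ B, c ≤ t i)
    (hts : ∀ i, Summable fun u => p i u * t u)
    (hgap : ∀ i ∉ B, ∑' j, p i j * t j ≤ ρ * t i) {i : S}
    (hrec : Tendsto (fun n => survival p B n i) atTop (𝓝 0)) (n : ℕ) :
    survival p B n i ≤ ρ ^ (n + 1) * (t i / (c * (1 - ρ))) := by
  have h1ρ : 0 < 1 - ρ := sub_pos.2 hρ₁
  set D := t i / (c * (1 - ρ)) with hD
  have hD₀ : 0 ≤ D := div_nonneg (ht i) (mul_pos hc h1ρ).le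
  have hDt : t i / c = D * (1 - ρ) := by
    rw [hD]
    field_simp
  have hk : ∀ k, survival p B n i ≤ survival p B (n + k) i + ρ ^ (n + 1) * D * (1 - ρ ^ k) := by
    intro k
    induction k with
    | zero => simp
    | succ k ih =>
      have h := hp.survival_sub_succ_le ht hρ hc htB hts hgap (n + k) i
      rw [mul_div_assoc, hDt] at h
      rw [← add_assoc]
      have e : ρ ^ (n + k + 1) * (D * (1 - ρ)) =
        ρ ^ (n + 1) * D * (1 - ρ ^ (k + 1)) - ρ ^ (n + 1) * D * (1 - ρ ^ k) := by ring
      linarith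
  have hlim : Tendsto (fun k => survival p B (n + k) i + ρ ^ (n + 1) * D) atTop
      (𝓝 (0 + ρ ^ (n + 1) * D)) := by
    refine Tendsto.add_const _ ?_
    simpa only [add_comm n] using (tendsto_add_atTop_iff_nat n).2 hrec
  rw [zero_add] at hlim
  refine ge_of_tendsto' hlim fun k => (hk k).trans ?_
  have : 0 ≤ ρ ^ (n + 1) * D * ρ ^ k := by positivity
  linarith

lemma mul_one_sub_survival_le_nstep (hp : IsStochastic p) {δ : ℝ} {N m : ℕ} {b : S}
    (hδ : ∀ b' ∈ B, ∀ k ≤ m, δ ≤ nstep p (N + k) b' b) (i : S) :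
    δ * (1 - survival p B m i) ≤ nstep p (N + m) i b := by
  induction m generalizing i with
  | zero =>
    by_cases hi : i ∈ B
    · simpa [survival_of_mem p hi] using hδ i hi 0 le_rfl
    · simpa [survival_zero_of_notMem p hi] using (hp.nstep_isStochastic N).nonneg i b
  | succ m ih =>
    by_cases hi : i ∈ B
    · simpa [survival_of_mem p hi] using hδ i hi (m + 1) le_rfl
    · have h : HasSum (fun j => p i j * (δ * (1 - survival p B m j)))
          (δ * (1 - survival p B (m + 1) i)) :=
        (((hp.hasSum i).sub (hp.hasSum_survival_succ hi m)).mul_left δ).congr_fun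
          fun j => by ring
      exact hasSum_le (fun j => mul_le_mul_of_nonneg_left
        (ih (fun b' hb' k hk => hδ b' hb' k (hk.trans m.le_succ)) j) (hp.nonneg i j)) h
        (hp.hasSum_nstep_succ (N + m) i b)

lemma nstep_pos_add (hp : IsStochastic p) {m n : ℕ} {i k j : S} (hm : 0 < nstep p m i k)
    (hn : 0 < nstep p n k j) : 0 < nstep p (m + n) i j :=
  (mul_pos hm hn).trans_le (hp.nstep_mul_le m n i k j)

lemma eventually_nstep_pos (hp : IsStochastic p) (hirr : ∀ i j, ∃ n, 1 ≤ n ∧ 0 < nstep p n i j)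
    (haper : ∀ i, ∀ d : ℕ, (∀ n, 1 ≤ n → 0 < nstep p n i i → d ∣ n) → d = 1) (i j : S) :
    ∀ᶠ n in atTop, 0 < nstep p n i j := by
  obtain ⟨r, -, hr⟩ := hirr i j
  let s : AddSubmonoid ℕ :=
    { carrier := {n | 0 < nstep p n j j}
      add_mem' := fun ha hb => hp.nstep_pos_add ha hb
      zero_mem' := by simp [nstep_zero] }
  have hgcd : Nat.setGcd (s : Set ℕ) = 1 :=
    haper j _ fun n _ hn => Nat.setGcd_dvd_of_mem (s := (s : Set ℕ)) hn
  obtain ⟨N, hN⟩ := Nat.exists_mem_closure_of_ge (s : Set ℕ)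
  filter_upwards [eventually_ge_atTop (r + N)] with n hn
  have h : n - r ∈ s := by
    have := hN (n - r) (by omega) (by simp [hgcd])
    rwa [AddSubmonoid.closure_eq] at this
  have := hp.nstep_pos_add hr h
  rwa [Nat.add_sub_cancel' (by omega)] at this

lemma hasSum_stationary_nstep (hp : IsStochastic p) {π : S → ℝ} (hπ : ∀ j, 0 ≤ π j)
    (hsum : HasSum π 1) (hstat : ∀ j, HasSum (fun i => π i * p i j) (π j)) (n : ℕ) (j : S) :
    HasSum (fun i => π i * nstep p n i j) (π j) := by
  induction n with
  | zero =>
    convert hasSum_single j ?_ using 1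
    · simp [nstep_zero]
    · intro i hi
      simp [nstep_zero, hi]
  | succ n ih =>
    have hs : Summable fun i => π i * nstep p (n + 1) i j :=
      hsum.summable.of_nonneg_of_le
        (fun i => mul_nonneg (hπ i) ((hp.nstep_isStochastic _).nonneg i j))
        fun i => mul_le_of_le_one_right (hπ i) ((hp.nstep_isStochastic _).le_one i j)
    have h := hasSum_comp_of_nonneg hπ hp.nonneg
      (fun u => (hp.nstep_isStochastic n).nonneg u j) (fun v => hp.hasSum_nstep_succ n v j)
      hs.hasSum hstat
    rw [ih.unique h]
    exact hs.hasSum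

lemma stationary_pos (hp : IsStochastic p) (hirr : ∀ i j, ∃ n, 1 ≤ n ∧ 0 < nstep p n i j)
    {π : S → ℝ} (hπ : ∀ j, 0 ≤ π j) (hsum : HasSum π 1)
    (hstat : ∀ j, HasSum (fun i => π i * p i j) (π j)) (j : S) : 0 < π j := by
  obtain ⟨i, hi⟩ : ∃ i, 0 < π i := by
    by_contra! h
    have h₀ : π = fun _ => 0 := funext fun i => le_antisymm (h i) (hπ i)
    rw [h₀] at hsum
    exact zero_ne_one (hasSum_zero.unique hsum)
  obtain ⟨n, -, hn⟩ := hirr i j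
  exact (mul_pos hi hn).trans_le (le_hasSum (hp.hasSum_stationary_nstep hπ hsum hstat n j) i
    fun k _ => mul_nonneg (hπ k) ((hp.nstep_isStochastic n).nonneg k j))

/-- Every bounded nonnegative subharmonic function of an irreducible chain with a stationary
distribution which vanishes somewhere is zero. -/
lemma eq_zero_of_subharmonic (hp : IsStochastic p)
    (hirr : ∀ i j, ∃ n, 1 ≤ n ∧ 0 < nstep p n i j)
    {π : S → ℝ} (hπ : ∀ j, 0 ≤ π j) (hsum : HasSum π 1)
    (hstat : ∀ j, HasSum (fun i => π i * p i j) (π j)) {h : S → ℝ} (h₀ : ∀ i, 0 ≤ h i)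
    (h₁ : ∀ i, h i ≤ 1) (hsub : ∀ i, h i ≤ ∑' j, p i j * h j) {b : S} (hb : h b = 0) (i : S) :
    h i = 0 := by
  have hPs : ∀ i, HasSum (fun j => p i j * h j) (∑' j, p i j * h j) := fun i =>
    (hp.summable_mul h₀ h₁ i).hasSum
  have hsummable : ∀ g : S → ℝ, (∀ i, 0 ≤ g i ∧ g i ≤ 1) → Summable fun i => π i * g i :=
    fun g hg => hsum.summable.of_nonneg_of_le (fun i => mul_nonneg (hπ i) (hg i).1)
      fun i => mul_le_of_le_one_right (hπ i) (hg i).2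
  have hsP := hsummable _ (hp.tsum_mul_mem h₀ h₁)
  have hs := hsummable h fun i => ⟨h₀ i, h₁ i⟩
  have heq := hs.hasSum.unique (hasSum_comp_of_nonneg hπ hp.nonneg h₀ hPs hsP.hasSum hstat)
  have hdiff := hsP.hasSum.sub hs.hasSum
  rw [heq, sub_self, hasSum_zero_iff_of_nonneg
    fun i => sub_nonneg.2 (mul_le_mul_of_nonneg_left (hsub i) (hπ i))] at hdiff
  have hharm : ∀ i, HasSum (fun j => p i j * h j) (h i) := by
    intro i
    have hi : π i * (∑' j, p i j * h j) - π i * h i = 0 := congrFun hdiff i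
    rw [sub_eq_zero] at hi
    have := hPs i
    rwa [mul_left_cancel₀ (hp.stationary_pos hirr hπ hsum hstat i).ne' hi] at this
  have hharm_n : ∀ n i, HasSum (fun j => nstep p n i j * h j) (h i) := by
    intro n
    induction n with
    | zero => exact hasSum_nstep_zero h
    | succ n ih =>
      exact fun i => hasSum_comp_of_nonneg (hp.nonneg i) (hp.nstep_isStochastic n).nonneg h₀ ih
        (hharm i) (hp.hasSum_nstep_succ n i)
  obtain ⟨n, -, hn⟩ := hirr b i
  have hz := hharm_n n b
  rw [hb, hasSum_zero_iff_of_nonneg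
    fun j => mul_nonneg ((hp.nstep_isStochastic n).nonneg b j) (h₀ j)] at hz
  exact (mul_eq_zero.1 (congrFun hz i)).resolve_left hn.ne'

lemma tendsto_survival (hp : IsStochastic p) (hirr : ∀ i j, ∃ n, 1 ≤ n ∧ 0 < nstep p n i j)
    {π : S → ℝ} (hπ : ∀ j, 0 ≤ π j) (hsum : HasSum π 1)
    (hstat : ∀ j, HasSum (fun i => π i * p i j) (π j)) (hB : B.Nonempty) (i : S) :
    Tendsto (fun n => survival p B n i) atTop (𝓝 0) := by
  have hbdd : ∀ i, BddBelow (Set.range fun n => survival p B n i) := fun i =>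
    ⟨0, by rintro _ ⟨n, rfl⟩; exact (hp.survival_mem_Icc n i).1⟩
  have hlim : ∀ i, Tendsto (fun n => survival p B n i) atTop (𝓝 (⨅ n, survival p B n i)) :=
    fun i => tendsto_atTop_ciInf (hp.antitone_survival i) (hbdd i)
  have h₀ : ∀ i, 0 ≤ ⨅ n, survival p B n i := fun i =>
    le_ciInf fun n => (hp.survival_mem_Icc n i).1
  have h₁ : ∀ i, ⨅ n, survival p B n i ≤ 1 := fun i =>
    (ciInf_le (hbdd i) 0).trans (hp.survival_mem_Icc 0 i).2
  have hsub : ∀ i, ⨅ n, survival p B n i ≤ ∑' j, p i j * ⨅ n, survival p B n j := by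
    intro i
    by_cases hi : i ∈ B
    · simpa [survival_of_mem p hi] using
        (hp.tsum_mul_mem h₀ h₁ i).1
    · have hl : Tendsto (fun n => ∑' j, p i j * survival p B n j) atTop
          (𝓝 (∑' j, p i j * ⨅ n, survival p B n j)) := by
        refine tendsto_tsum_of_dominated_convergence (hp.hasSum i).summable
          (fun j => (hlim j).const_mul _) (Eventually.of_forall fun n j => ?_)
        have hm := hp.survival_mem_Icc (B := B) n j
        rw [Real.norm_of_nonneg (mul_nonneg (hp.nonneg i j) hm.1)]
        exact mul_le_of_le_one_right (hp.nonneg i j) hm.2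
      refine ge_of_tendsto' hl fun n => ?_
      rw [(hp.hasSum_survival_succ hi n).tsum_eq]
      exact ciInf_le (hbdd i) (n + 1)
  obtain ⟨b, hb⟩ := hB
  have hz := hp.eq_zero_of_subharmonic hirr hπ hsum hstat h₀ h₁ hsub
    (b := b) (by simp [survival_of_mem p hb]) i
  simpa [hz] using hlim i

end IsStochastic

namespace IsStochastic

variable {S : Type*} {p : S → S → ℝ} {B : Set S}

lemma exists_forall_le_nstep (hp : IsStochastic p)
    (hirr : ∀ i j, ∃ n, 1 ≤ n ∧ 0 < nstep p n i j)
    (haper : ∀ i, ∀ d : ℕ, (∀ n, 1 ≤ n → 0 < nstep p n i i → d ∣ n) → d = 1)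
    {π : S → ℝ} (hπ : ∀ j, 0 ≤ π j) (hsum : HasSum π 1)
    (hstat : ∀ j, HasSum (fun i => π i * p i j) (π j))
    (hBfin : B.Finite) (hBne : B.Nonempty) {t : S → ℝ} (ht : ∀ i, 0 < t i) {ρ : ℝ}
    (hρ : 0 ≤ ρ) (hρ₁ : ρ < 1) (hts : ∀ i, Summable fun u => p i u * t u)
    (hgap : ∀ i ∉ B, ∑' j, p i j * t j ≤ ρ * t i) (R : ℝ) (b : S) :
    ∃ M, 1 ≤ M ∧ ∃ ε : ℝ, 0 < ε ∧ ∀ i, t i ≤ R → ε ≤ nstep p M i b := by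
  obtain ⟨b₀, -, hb₀⟩ := B.exists_min_image t hBfin hBne
  have h1ρ : 0 < 1 - ρ := sub_pos.2 hρ₁
  have hcρ : 0 < t b₀ * (1 - ρ) := mul_pos (ht b₀) h1ρ
  obtain ⟨m, hm⟩ : ∃ m : ℕ, ρ ^ (m + 1) * (R / (t b₀ * (1 - ρ))) < 1 / 2 := by
    have h := ((tendsto_pow_atTop_nhds_zero_of_lt_one hρ hρ₁).comp
      (tendsto_add_atTop_nat 1)).mul_const (R / (t b₀ * (1 - ρ)))
    rw [zero_mul] at h
    exact (h.eventually_lt_const (by norm_num)).exists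
  have hpos : ∀ᶠ n in atTop, ∀ b' ∈ B, 0 < nstep p n b' b :=
    (Filter.eventually_all_finite hBfin).2 fun b' _ => hp.eventually_nstep_pos hirr haper b' b
  obtain ⟨N, hN⟩ := eventually_atTop.1 hpos
  obtain ⟨⟨b₁, k₁⟩, ⟨hb₁, -⟩, hmin⟩ := (B ×ˢ Set.Iic m).exists_min_image
    (fun x => nstep p (N + 1 + x.2) x.1 b) (hBfin.prod (Set.finite_Iic m))
    (hBne.prod ⟨0, Nat.zero_le m⟩)
  refine ⟨N + 1 + m, by omega, nstep p (N + 1 + k₁) b₁ b / 2,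
    half_pos (hN _ (by omega) b₁ hb₁), fun i hi => ?_⟩
  have hδ := hp.mul_one_sub_survival_le_nstep (N := N + 1) (m := m)
    (fun b' hb' k hk => hmin (b', k) ⟨hb', hk⟩) i
  have hsurv : survival p B m i ≤ 1 / 2 := by
    refine (hp.survival_le_of_tendsto_zero (fun i => (ht i).le) hρ hρ₁ (ht b₀) hb₀ hts hgap
      (hp.tendsto_survival hirr hπ hsum hstat hBne i) m).trans (le_trans ?_ hm.le)
    gcongr
  have := mul_le_mul_of_nonneg_left (by linarith : 1 / 2 ≤ 1 - survival p B m i)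
    (hN (N + 1 + k₁) (by omega) b₁ hb₁).le
  dsimp only at hδ
  linarith

lemma abs_nstep_sub_le (hp : IsStochastic p) {t : S → ℝ} (ht : ∀ i, 0 ≤ t i) {M : ℕ} {α β : ℝ}
    (hα : 0 ≤ α) (hβ : 0 ≤ β)
    (hcontr : ∀ (A : ℝ) (f g : S → ℝ), 0 ≤ A → (∀ i, HasSum (fun u => nstep p M i u * f u) (g i)) →
      (∀ u v, |f u - f v| ≤ A * (2 + β * t u + β * t v)) →
      ∀ x y, |g x - g y| ≤ A * α * (2 + β * t x + β * t y))
    (k r : ℕ) (x y j : S) :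
    |nstep p (M * k + r) x j - nstep p (M * k + r) y j| ≤
      α ^ k * (2 + β * t x + β * t y) := by
  induction k generalizing x y with
  | zero =>
    have hx := (hp.nstep_isStochastic r).nonneg x j
    have hy := (hp.nstep_isStochastic r).nonneg y j
    have hx' := (hp.nstep_isStochastic r).le_one x j
    have hy' := (hp.nstep_isStochastic r).le_one y j
    have h₁ := mul_nonneg hβ (ht x)
    have h₂ := mul_nonneg hβ (ht y)
    rw [mul_zero, zero_add, pow_zero, abs_le]
    constructor <;> linarith
  | succ k ih =>
    have e : M * (k + 1) + r = M + (M * k + r) := by ring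
    rw [e, pow_succ]
    exact hcontr _ _ _ (pow_nonneg hα k) (fun i => hp.hasSum_nstep_add M (M * k + r) i j) ih x y

lemma tendsto_nstep_of_abs_sub_le (hp : IsStochastic p) {π : S → ℝ} (hπ : ∀ j, 0 ≤ π j)
    (hsum : HasSum π 1) (hstat : ∀ j, HasSum (fun i => π i * p i j) (π j)) {x j : S}
    (hmerge : ∀ y, Tendsto (fun n => nstep p n x j - nstep p n y j) atTop (𝓝 0)) :
    Tendsto (fun n => nstep p n x j) atTop (𝓝 (π j)) := by
  have hl : Tendsto (fun n => ∑' y, π y * (nstep p n x j - nstep p n y j)) atTop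
      (𝓝 (∑' y, π y * 0)) := by
    refine tendsto_tsum_of_dominated_convergence hsum.summable
      (fun y => (hmerge y).const_mul _) (Eventually.of_forall fun n y => ?_)
    have hx := (hp.nstep_isStochastic n).nonneg x j
    have hy := (hp.nstep_isStochastic n).nonneg y j
    have hx' := (hp.nstep_isStochastic n).le_one x j
    have hy' := (hp.nstep_isStochastic n).le_one y j
    rw [norm_mul, Real.norm_of_nonneg (hπ y), Real.norm_eq_abs]
    exact mul_le_of_le_one_right (hπ y) (abs_le.2 ⟨by linarith, by linarith⟩)
  have e : ∀ n, ∑' y, π y * (nstep p n x j - nstep p n y j) = nstep p n x j - π j := by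
    intro n
    refine HasSum.tsum_eq ?_
    have h := (hsum.mul_right (nstep p n x j)).sub (hp.hasSum_stationary_nstep hπ hsum hstat n j)
    rw [one_mul] at h
    exact h.congr_fun fun y => by ring
  simp only [e, mul_zero, tsum_zero] at hl
  simpa using hl.add_const (π j)

lemma abs_nstep_sub_stationary_le (hp : IsStochastic p) {π t : S → ℝ}
    {β L : ℝ} (hβ : 0 ≤ β) {x j : S}
    (hdrift : ∀ n, ∃ T, HasSum (fun u => nstep p n x u * t u) T ∧ T ≤ L)
    (hlim : Tendsto (fun n => nstep p n x j) atTop (𝓝 (π j))) {n : ℕ} {A : ℝ} (hA : 0 ≤ A)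
    (hn : ∀ y, |nstep p n y j - nstep p n x j| ≤ A * (2 + β * t x + β * t y)) :
    |nstep p n x j - π j| ≤ A * (2 + β * t x + β * L) := by
  have hlim' : Tendsto (fun k => |nstep p n x j - nstep p (k + n) x j|) atTop
      (𝓝 |nstep p n x j - π j|) :=
    (tendsto_const_nhds.sub ((tendsto_add_atTop_iff_nat n).2 hlim)).abs
  refine le_of_tendsto' hlim' fun k => ?_
  obtain ⟨T, hT, hTL⟩ := hdrift k
  have hq := hp.nstep_isStochastic k
  have hd := (hp.hasSum_nstep_add k n x j).sub (hq.hasSum_const (nstep p n x j) x)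
  have hub := ((hq.hasSum_const (A * (2 + β * t x)) x).add (hT.mul_left (A * β)))
  have hAL : A * β * T ≤ A * β * L := mul_le_mul_of_nonneg_left hTL (mul_nonneg hA hβ)
  have hterm : ∀ u, |nstep p k x u * nstep p n u j - nstep p k x u * nstep p n x j| ≤
      nstep p k x u * (A * (2 + β * t x)) + A * β * (nstep p k x u * t u) := by
    intro u
    rw [← mul_sub, abs_mul, abs_of_nonneg (hq.nonneg x u)]
    refine (mul_le_mul_of_nonneg_left (hn u) (hq.nonneg x u)).trans_eq ?_
    ring
  have h₁ := hasSum_le (fun u => (abs_le.1 (hterm u)).2) hd hub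
  have h₂ := hasSum_le (fun u => (abs_le.1 (hterm u)).1) hub.neg hd
  rw [abs_sub_comm, abs_le]
  constructor <;> linarith

end IsStochastic

/-- Geometric decay along multiples of `M` gives geometric decay along all integers. -/
lemma exists_pow_div_le_mul_pow {M : ℕ} (hM : 1 ≤ M) {α : ℝ} (hα : 0 < α) (hα₁ : α < 1) :
    ∃ θ : ℝ, 0 < θ ∧ θ < 1 ∧ ∀ n : ℕ, α ^ (n / M) ≤ α⁻¹ * θ ^ n := by
  have hM₀ : (0 : ℝ) < M := by exact_mod_cast hM
  have hθM : (α ^ (M : ℝ)⁻¹) ^ M = α := Real.rpow_inv_natCast_pow hα.le (by omega)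
  have hθ : 0 < α ^ (M : ℝ)⁻¹ := Real.rpow_pos_of_pos hα _
  have hθ₁ : α ^ (M : ℝ)⁻¹ < 1 := Real.rpow_lt_one hα.le hα₁ (inv_pos.2 hM₀)
  refine ⟨α ^ (M : ℝ)⁻¹, hθ, hθ₁, fun n => ?_⟩
  rw [inv_mul_eq_div, le_div_iff₀ hα]
  generalize α ^ (M : ℝ)⁻¹ = θ at hθM hθ hθ₁
  rw [← hθM, ← pow_mul, ← pow_add]
  refine pow_le_pow_of_le_one hθ.le hθ₁.le ?_
  have h₁ := Nat.div_add_mod n M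
  have h₂ := Nat.mod_lt n hM
  omega

/-- Markov-chain form of the paper's main exponential mixing theorem (Theorem 4.5):
an irreducible aperiodic stochastic matrix with a stationary distribution satisfying the
weighted spectral gap condition converges exponentially to the stationary distribution. -/
theorem stmt_0 {S : Type*} [Countable S] (p : S → S → ℝ)
    (hp_nonneg : ∀ i j, 0 ≤ p i j)
    (hp_row : ∀ i, HasSum (fun j => p i j) 1)
    (hirr : ∀ i j, ∃ n, 1 ≤ n ∧ 0 < nstep p n i j)
    (haper : ∀ i, ∀ d : ℕ, (∀ n, 1 ≤ n → 0 < nstep p n i i → d ∣ n) → d = 1)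
    (π : S → ℝ) (hπ_nonneg : ∀ j, 0 ≤ π j) (hπ_sum : HasSum π 1)
    (hπ_stat : ∀ j, HasSum (fun i => π i * p i j) (π j))
    (t : S → ℝ) (ht : ∀ i, 0 < t i)
    (B : Set S) (hBfin : B.Finite) (hBne : B.Nonempty)
    (ρ : ℝ) (hρ0 : 0 < ρ) (hρ1 : ρ < 1)
    (hsum : ∀ i, Summable fun j => p i j * t j)
    (hWSG : ∀ i ∉ B, ∑' j, p i j * t j ≤ ρ * t i) :
    ∃ θ : ℝ, 0 < θ ∧ θ < 1 ∧ ∃ C : S → S → ℝ, (∀ i j, 0 < C i j) ∧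
      ∀ i j n, 1 ≤ n → |nstep p n i j - π j| ≤ C i j * θ ^ n := by
  have hp : IsStochastic p := ⟨hp_nonneg, hp_row⟩
  have ht₀ : ∀ i, 0 ≤ t i := fun i => (ht i).le
  have h1ρ : 0 < 1 - ρ := sub_pos.2 hρ1
  have hPt₀ : ∀ i, 0 ≤ ∑' j, p i j * t j := fun i =>
    tsum_nonneg fun j => mul_nonneg (hp_nonneg i j) (ht₀ j)
  obtain ⟨b, -⟩ := id hBne
  obtain ⟨K, hK, hdrift⟩ : ∃ K : ℝ, 0 ≤ K ∧
      ∀ i, ∑' j, p i j * t j ≤ ρ * t i + K * (1 - ρ) := by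
    have hK₀ : 0 ≤ ∑ i ∈ hBfin.toFinset, ∑' j, p i j * t j :=
      Finset.sum_nonneg fun i _ => hPt₀ i
    refine ⟨(∑ i ∈ hBfin.toFinset, ∑' j, p i j * t j) / (1 - ρ),
      div_nonneg hK₀ h1ρ.le, fun i => ?_⟩
    rw [div_mul_cancel₀ _ h1ρ.ne']
    by_cases hi : i ∈ B
    · have := Finset.single_le_sum (f := fun i => ∑' j, p i j * t j) (fun i _ => hPt₀ i)
        (hBfin.mem_toFinset.2 hi)
      exact this.trans (le_add_of_nonneg_left (mul_nonneg hρ0.le (ht₀ i)))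
    · exact (hWSG i hi).trans (le_add_of_nonneg_right hK₀)
  have hdrift_n := hp.nstep_drift ht₀ hρ0.le hsum hdrift
  obtain ⟨M, hM, ε, hε, hmin⟩ := hp.exists_forall_le_nstep hirr haper hπ_nonneg hπ_sum hπ_stat
    hBfin hBne ht hρ0.le hρ1 hsum hWSG (8 * (K + 1) / (1 - ρ)) b
  obtain ⟨β, hβ, hβK⟩ : ∃ β : ℝ, 0 < β ∧ β * K ≤ ε ^ 2 / 2 := by
    refine ⟨ε ^ 2 / 2 / (K + 1), by positivity, ?_⟩
    rw [div_mul_eq_mul_div, div_le_iff₀ (by positivity)]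
    exact mul_le_mul_of_nonneg_left (by linarith) (by positivity)
  obtain ⟨α, hα₀, hα₁, hαρ, hαβ, hαε⟩ : ∃ α : ℝ, 0 < α ∧ α < 1 ∧ (1 + ρ) / 2 ≤ α ∧
      1 - β ≤ α ∧ 1 - ε ^ 2 / 2 ≤ α := by
    refine ⟨max ((1 + ρ) / 2) (max (1 - β) (1 - ε ^ 2 / 2)), lt_max_of_lt_left (by linarith),
      max_lt (by linarith) (max_lt (by linarith) ?_), le_max_left _ _,
      (le_max_left _ _).trans (le_max_right _ _), (le_max_right _ _).trans (le_max_right _ _)⟩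
    have : 0 < ε ^ 2 := by positivity
    linarith
  have hdriftM : ∀ i, ∑' u, nstep p M i u * t u ≤ ρ * t i + K := by
    intro i
    obtain ⟨T, hT, hTle⟩ := hdrift_n M i
    rw [hT.tsum_eq]
    have h₁ := mul_le_mul_of_nonneg_right (pow_le_of_le_one hρ0.le hρ1.le (by omega : M ≠ 0)) (ht₀ i)
    have h₂ : 0 ≤ K * ρ ^ M := by positivity
    linarith
  have hmerge := hp.abs_nstep_sub_le ht₀ hα₀.le hβ.le (M := M) fun A f g hA hfg hf =>
    (hp.nstep_isStochastic M).abs_sub_le_of_drift_of_minorization ht₀ hρ1 rfl hε hβ hβK hαρ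
      hαβ hαε (fun i => (hdrift_n M i).choose_spec.1.summable) hdriftM hmin hA hfg hf
  obtain ⟨θ, hθ₀, hθ₁, hθ⟩ := exists_pow_div_le_mul_pow hM hα₀ hα₁
  have hD : ∀ x y, 0 < 2 + β * t x + β * t y := fun x y => by
    have := mul_nonneg hβ.le (ht₀ x)
    have := mul_nonneg hβ.le (ht₀ y)
    linarith
  have hrate : ∀ n x y j, |nstep p n x j - nstep p n y j| ≤
      α⁻¹ * θ ^ n * (2 + β * t x + β * t y) := by
    intro n x y j
    have h := hmerge (n / M) (n % M) x y j
    rw [Nat.div_add_mod] at h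
    exact h.trans (mul_le_mul_of_nonneg_right (hθ n) (hD x y).le)
  refine ⟨θ, hθ₀, hθ₁, fun i _ => α⁻¹ * (2 + β * t i + β * (t i + K)), fun i _ => ?_,
    fun i j n _ => ?_⟩
  · have := ht i
    positivity
  · have hlim := hp.tendsto_nstep_of_abs_sub_le hπ_nonneg hπ_sum hπ_stat (x := i) (j := j)
      fun y => by
        refine squeeze_zero_norm (fun n => hrate n i y j) ?_
        simpa using ((tendsto_pow_atTop_nhds_zero_of_lt_one hθ₀.le hθ₁).const_mul α⁻¹).mul_const
          (2 + β * t i + β * t y)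
    refine (hp.abs_nstep_sub_stationary_le hβ.le (L := t i + K) (fun k => ?_) hlim
      (A := α⁻¹ * θ ^ n) (by positivity) fun y => ?_).trans_eq (by ring)
    · obtain ⟨T, hT, hTle⟩ := hdrift_n k i
      have h₁ := mul_le_mul_of_nonneg_right (pow_le_one₀ hρ0.le hρ1.le (n := k)) (ht₀ i)
      have h₂ : 0 ≤ K * ρ ^ k := by positivity
      exact ⟨T, hT, by linarith⟩
    · rw [abs_sub_comm]
      exact hrate n i y j
end

section
/- Let p be an irreducible and aperiodic stochastic matrix on a countable set S admitting a stationary distribution π. Suppose p satisfies the weighted spectral gap condition with data (t, B, ρ), where the finite set B is nonempty, and suppose moreover that Σ_{j∈S} p(i,j)·t_j < ∞ for every i ∈ B. Then there exists θ ∈ (0,1) such that for all finite words a = (a_0,…,a_{k−1}) ∈ S^k and b = (b_0,…,b_{l−1}) ∈ S^l there is a constant C(a,b) > 0 with |Σ_{c∈S^{n−k}} λ(a⌢c⌢b) − λ(a)·λ(b)| ≤ C(a,b)·θ^n for all n ≥ k. (Symbolic-dynamics form of the paper's main theorem: exponential decay of correlations of cylinder functions for the shift-invariant Markov measure.) -/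
open scoped Classical

/-- Product of transition probabilities along a path starting at `a`. -/
noncomputable def chainWeight {S : Type*} (p : S → S → ℝ) : S → List S → ℝ
  | _, [] => 1
  | a, b :: rest => p a b * chainWeight p b rest

/-- Markov weight of a finite word: `λ(a₀,…,a_{k-1}) = π_{a₀} ∏ p(a_i, a_{i+1})`,
the measure of the corresponding cylinder set for the shift-invariant Markov measure. -/
noncomputable def wordWeight {S : Type*} (p : S → S → ℝ) (π : S → ℝ) : List S → ℝ
  | [] => 0
  | a :: rest => π a * chainWeight p a rest

namespace CountableMarkov

/-- The functions bounded in absolute value by a multiple of the weight `W`. -/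
def weightedBounded {S : Type*} (W : S → ℝ) : Submodule ℝ (S → ℝ) where
  carrier := {f | ∃ C, ∀ i, |f i| ≤ C * W i}
  add_mem' := by
    rintro f g ⟨C, hC⟩ ⟨D, hD⟩
    refine ⟨C + D, fun i => (abs_add_le _ _).trans ?_⟩
    linarith [hC i, hD i]
  zero_mem' := ⟨0, fun i => by simp⟩
  smul_mem' := by
    rintro a f ⟨C, hC⟩
    refine ⟨|a| * C, fun i => ?_⟩
    simpa [abs_mul, mul_assoc] using mul_le_mul_of_nonneg_left (hC i) (abs_nonneg a)

lemma mem_weightedBounded_of_abs_le {S : Type*} {W f : S → ℝ} (C : ℝ)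
    (h : ∀ i, |f i| ≤ C * W i) : f ∈ weightedBounded W :=
  ⟨C, h⟩

/-- A unital positive linear operator on a space `E` of real functions. -/
structure IsMarkovOperator {S : Type*} (E : Submodule ℝ (S → ℝ))
    (T : (S → ℝ) → S → ℝ) : Prop where
  one_mem : (1 : S → ℝ) ∈ E
  map_mem : ∀ f ∈ E, T f ∈ E
  map_add : ∀ f ∈ E, ∀ g ∈ E, T (f + g) = T f + T g
  map_smul : ∀ c : ℝ, ∀ f ∈ E, T (c • f) = c • T f
  map_one : T 1 = 1
  map_nonneg : ∀ f ∈ E, 0 ≤ f → 0 ≤ T f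

namespace IsMarkovOperator

variable {S : Type*} {E : Submodule ℝ (S → ℝ)} {T : (S → ℝ) → S → ℝ}

lemma map_sub (hT : IsMarkovOperator E T) {f g : S → ℝ} (hf : f ∈ E) (hg : g ∈ E) :
    T (f - g) = T f - T g := by
  have h := hT.map_add (f - g) (E.sub_mem hf hg) g hg
  rw [sub_add_cancel] at h
  rw [h, add_sub_cancel_right]

lemma map_const (hT : IsMarkovOperator E T) (c : ℝ) : T (c • 1) = c • 1 := by
  rw [hT.map_smul c 1 hT.one_mem, hT.map_one]

lemma mono (hT : IsMarkovOperator E T) {f g : S → ℝ} (hf : f ∈ E) (hg : g ∈ E) (h : f ≤ g) :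
    T f ≤ T g := by
  have h' := hT.map_nonneg (g - f) (E.sub_mem hg hf) (sub_nonneg.2 h)
  rwa [hT.map_sub hg hf, sub_nonneg] at h'

lemma iterate (hT : IsMarkovOperator E T) (n : ℕ) : IsMarkovOperator E (T^[n]) := by
  induction n with
  | zero => exact ⟨hT.one_mem, fun _ h => h, fun _ _ _ _ => rfl, fun _ _ _ => rfl, rfl,
      fun _ _ h => h⟩
  | succ n ih =>
    simp only [Function.iterate_succ']
    refine ⟨hT.one_mem, fun f hf => hT.map_mem _ (ih.map_mem f hf), fun f hf g hg => ?_,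
      fun c f hf => ?_, ?_, fun f hf h => hT.map_nonneg _ (ih.map_mem f hf) (ih.map_nonneg f hf h)⟩
    · simp only [Function.comp, ih.map_add f hf g hg]
      exact hT.map_add _ (ih.map_mem f hf) _ (ih.map_mem g hg)
    · simp only [Function.comp, ih.map_smul c f hf]
      exact hT.map_smul c _ (ih.map_mem f hf)
    · simp only [Function.comp, ih.map_one, hT.map_one]

/-- If `φ` is within `M (1 + β V)` of a constant, then `T φ` is within `M (1 + β T V)` of it. -/
lemma abs_sub_const_le (hT : IsMarkovOperator E T) {V φ : S → ℝ} (hV : V ∈ E) (hφ : φ ∈ E)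
    {M β c : ℝ} (h : ∀ z, |φ z - c| ≤ M * (1 + β * V z)) (x : S) :
    |T φ x - c| ≤ M * (1 + β * T V x) := by
  have h1 := hT.one_mem
  have hb : (M • 1 + (M * β) • V : S → ℝ) ∈ E :=
    E.add_mem (E.smul_mem _ h1) (E.smul_mem _ hV)
  have hc : (c • 1 : S → ℝ) ∈ E := E.smul_mem _ h1
  have hTb : T (M • 1 + (M * β) • V) = M • 1 + (M * β) • T V := by
    rw [hT.map_add _ (E.smul_mem _ h1) _ (E.smul_mem _ hV), hT.map_const, hT.map_smul _ _ hV]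
  have hup := hT.mono (E.sub_mem hφ hc) hb (fun z => by
    have := (abs_le.1 (h z)).2
    simp only [Pi.sub_apply, Pi.add_apply, Pi.smul_apply, Pi.one_apply, smul_eq_mul]
    linarith) x
  have hlo := hT.mono (E.sub_mem hc hφ) hb (fun z => by
    have := (abs_le.1 (h z)).1
    simp only [Pi.sub_apply, Pi.add_apply, Pi.smul_apply, Pi.one_apply, smul_eq_mul]
    linarith) x
  rw [hTb, hT.map_sub hφ hc, hT.map_const] at hup
  rw [hTb, hT.map_sub hc hφ, hT.map_const] at hlo
  simp only [Pi.sub_apply, Pi.add_apply, Pi.smul_apply, Pi.one_apply, smul_eq_mul] at hup hlo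
  rw [abs_le]
  constructor <;> linarith

/-- Two-point estimate under the minorization `α f(j) ≤ T f` at `x` and `y`. -/
lemma abs_sub_le_of_minorization (hT : IsMarkovOperator E T) {V φ : S → ℝ} (hV : V ∈ E)
    (hV0 : 0 ≤ V) (hφ : φ ∈ E) {M β c α : ℝ} (hM : 0 ≤ M) (hβ : 0 ≤ β) (hα : 0 ≤ α)
    (h : ∀ z, |φ z - c| ≤ M * (1 + β * V z)) {x y j : S}
    (hx : ∀ f ∈ E, 0 ≤ f → α * f j ≤ T f x) (hy : ∀ f ∈ E, 0 ≤ f → α * f j ≤ T f y) :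
    |T φ x - T φ y| ≤ M * (2 - 2 * α + β * (T V x + T V y)) := by
  have h1 := hT.one_mem
  have hb : (M • 1 + (M * β) • V : S → ℝ) ∈ E :=
    E.add_mem (E.smul_mem _ h1) (E.smul_mem _ hV)
  have hc : (c • 1 : S → ℝ) ∈ E := E.smul_mem _ h1
  have hTb : T (M • 1 + (M * β) • V) = M • 1 + (M * β) • T V := by
    rw [hT.map_add _ (E.smul_mem _ h1) _ (E.smul_mem _ hV), hT.map_const, hT.map_smul _ _ hV]
  have hup : (0 : S → ℝ) ≤ (M • 1 + (M * β) • V) - (φ - c • 1) := fun z => by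
    have := (abs_le.1 (h z)).2
    simp only [Pi.sub_apply, Pi.add_apply, Pi.smul_apply, Pi.one_apply, smul_eq_mul, Pi.zero_apply]
    linarith
  have hlo : (0 : S → ℝ) ≤ (M • 1 + (M * β) • V) - (c • 1 - φ) := fun z => by
    have := (abs_le.1 (h z)).1
    simp only [Pi.sub_apply, Pi.add_apply, Pi.smul_apply, Pi.one_apply, smul_eq_mul, Pi.zero_apply]
    linarith
  have ux := hx _ (E.sub_mem hb (E.sub_mem hφ hc)) hup
  have uy := hy _ (E.sub_mem hb (E.sub_mem hφ hc)) hup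
  have lx := hx _ (E.sub_mem hb (E.sub_mem hc hφ)) hlo
  have ly := hy _ (E.sub_mem hb (E.sub_mem hc hφ)) hlo
  rw [hT.map_sub hb (E.sub_mem hφ hc), hTb, hT.map_sub hφ hc, hT.map_const] at ux uy
  rw [hT.map_sub hb (E.sub_mem hc hφ), hTb, hT.map_sub hc hφ, hT.map_const] at lx ly
  simp only [Pi.sub_apply, Pi.add_apply, Pi.smul_apply, Pi.one_apply, smul_eq_mul] at ux uy lx ly
  have hj : 0 ≤ α * (M * β * V j) := mul_nonneg hα (mul_nonneg (mul_nonneg hM hβ) (hV0 j))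
  rw [abs_le]
  constructor <;> linarith

end IsMarkovOperator

/-- A function whose two-point differences are dominated by `g x + g y` lies within `g` of some
constant. -/
lemma exists_const_abs_sub_le {S : Type*} [Nonempty S] {f g : S → ℝ}
    (h : ∀ x y, |f x - f y| ≤ g x + g y) : ∃ c, ∀ z, |f z - c| ≤ g z := by
  obtain ⟨w⟩ := ‹Nonempty S›
  have hle : ∀ z w, f z - g z ≤ f w + g w := fun z w => by
    linarith [(abs_le.1 (h z w)).2]
  have hbdd : BddAbove (Set.range fun z => f z - g z) :=
    ⟨f w + g w, by rintro _ ⟨z, rfl⟩; exact hle z w⟩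
  have : Nonempty S := ⟨w⟩
  refine ⟨⨆ z, (f z - g z), fun z => abs_le.2 ⟨?_, ?_⟩⟩
  · linarith [ciSup_le (fun w => hle w z)]
  · linarith [le_ciSup hbdd z]

/-- **Harris contraction**, in the weighted seminorm of Hairer and Mattingly. -/
theorem IsMarkovOperator.exists_contraction {S : Type*} [Nonempty S] {V : S → ℝ}
    {E : Submodule ℝ (S → ℝ)} {T : (S → ℝ) → S → ℝ} (hT : IsMarkovOperator E T)
    (hVE : V ∈ E) (hV : 0 ≤ V) {γ K R α : ℝ} (hγ0 : 0 < γ) (hγ1 : γ < 1) (hK : 0 < K)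
    (hR : 0 < R) (hKR : 4 * K ≤ (1 - γ) * R) (hα : 0 < α)
    (hdrift : ∀ x, T V x ≤ γ * V x + K) (j : S)
    (hminor : ∀ x, V x ≤ R → ∀ f ∈ E, 0 ≤ f → α * f j ≤ T f x) :
    ∃ β θ : ℝ, 0 < β ∧ 0 < θ ∧ θ < 1 ∧ ∀ M, 0 ≤ M → ∀ φ ∈ E,
      (∃ c, ∀ z, |φ z - c| ≤ M * (1 + β * V z)) →
      ∃ c, ∀ z, |T φ z - c| ≤ θ * M * (1 + β * V z) := by
  set β := α / (2 * K) with hβdef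
  have hβ : 0 < β := by positivity
  have hβK : 2 * (β * K) = α := by rw [hβdef]; field_simp
  set γ' := (1 + γ) / 2 with hγ'def
  set θ₁ := (2 + β * R * γ') / (2 + β * R) with hθ₁def
  have hβR : 0 < β * R := mul_pos hβ hR
  have hθ₁ : θ₁ * (2 + β * R) = 2 + β * R * γ' := by rw [hθ₁def]; field_simp
  have hθ₁1 : θ₁ < 1 := by
    rw [hθ₁def, div_lt_one (by positivity)]
    nlinarith
  have hθ₁γ : γ' ≤ θ₁ := by
    rw [hθ₁def, le_div_iff₀ (by positivity)]
    nlinarith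
  set θ := max θ₁ (max (1 - α / 2) γ) with hθdef
  have hθ1 : θ₁ ≤ θ := le_max_left _ _
  have hθ2 : 1 - α / 2 ≤ θ := (le_max_left _ _).trans (le_max_right _ _)
  have hθ3 : γ ≤ θ := (le_max_right _ _).trans (le_max_right _ _)
  refine ⟨β, θ, hβ, hγ0.trans_le hθ3, max_lt hθ₁1 (max_lt (by linarith) hγ1), ?_⟩
  rintro M hM φ hφ ⟨c, hc⟩
  refine exists_const_abs_sub_le fun x y => ?_
  have hx0 := hV x
  have hy0 := hV y
  simp only [Pi.zero_apply] at hx0 hy0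
  have hdx := hdrift x
  have hdy := hdrift y
  suffices h : ∃ D, |T φ x - T φ y| ≤ M * D ∧ D ≤ θ * (2 + β * (V x + V y)) by
    obtain ⟨D, h1, h2⟩ := h
    calc |T φ x - T φ y| ≤ M * D := h1
      _ ≤ M * (θ * (2 + β * (V x + V y))) := mul_le_mul_of_nonneg_left h2 hM
      _ = _ := by ring
  have hTV : β * (T V x + T V y) ≤ β * (γ * (V x + V y) + 2 * K) :=
    mul_le_mul_of_nonneg_left (by linarith) hβ.le
  by_cases hs : V x + V y ≤ R
  · refine ⟨2 - 2 * α + β * (T V x + T V y),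
      hT.abs_sub_le_of_minorization hVE hV hφ hM hβ.le hα.le hc
        (hminor x (by linarith)) (hminor y (by linarith)), ?_⟩
    have : γ * (β * (V x + V y)) ≤ θ * (β * (V x + V y)) :=
      mul_le_mul_of_nonneg_right hθ3 (by positivity)
    linarith
  · refine ⟨2 + β * (T V x + T V y), ?_, ?_⟩
    · have h1 := abs_le.1 (hT.abs_sub_const_le hVE hφ hc x)
      have h2 := abs_le.1 (hT.abs_sub_const_le hVE hφ hc y)
      rw [abs_le]
      constructor <;> linarith [h1.1, h1.2, h2.1, h2.2]
    · push Not at hs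
      have h1 : 2 * K ≤ (1 - γ) / 2 * (V x + V y) := by nlinarith
      have h2 : β * (2 * K) ≤ β * ((1 - γ) / 2 * (V x + V y)) :=
        mul_le_mul_of_nonneg_left h1 hβ.le
      have h3 : θ₁ * (2 + β * (V x + V y)) ≤ θ * (2 + β * (V x + V y)) :=
        mul_le_mul_of_nonneg_right hθ1 (by positivity)
      have h4 : 0 ≤ (θ₁ - γ') * (β * (V x + V y - R)) :=
        mul_nonneg (by linarith) (mul_nonneg hβ.le (by linarith))
      have h5 : γ' * (β * (V x + V y)) = (β * γ * (V x + V y) + β * (V x + V y)) / 2 := by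
        rw [hγ'def]; ring
      nlinarith

/-- The indicator function of a point. -/
noncomputable def pointMass {S : Type*} (j : S) : S → ℝ :=
  fun i => if i = j then 1 else 0

lemma pointMass_apply {S : Type*} (j i : S) : pointMass j i = if i = j then 1 else 0 := rfl

lemma pointMass_nonneg {S : Type*} (j : S) : 0 ≤ pointMass j := fun i => by
  rw [pointMass_apply]; split_ifs <;> simp

namespace IsMarkovOperator

variable {S : Type*} {E : Submodule ℝ (S → ℝ)} {P : (S → ℝ) → S → ℝ}

lemma iterate_drift (hP : IsMarkovOperator E P) {V : S → ℝ} (hVE : V ∈ E) {γ K : ℝ}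
    (hγ0 : 0 < γ) (hγ1 : γ < 1) (hK : 0 ≤ K) (hdrift : ∀ x, P V x ≤ γ * V x + K) (n : ℕ)
    (x : S) : P^[n] V x ≤ γ ^ n * V x + K / (1 - γ) := by
  have h1γ : 0 < 1 - γ := by linarith
  have hK' : γ * (K / (1 - γ)) + K = K / (1 - γ) := by field_simp; ring
  induction n generalizing x with
  | zero => simpa using div_nonneg hK h1γ.le
  | succ n ih =>
    have hPn := hP.iterate n
    have h1 := hPn.one_mem
    have hle := hPn.mono (hP.map_mem V hVE) (E.add_mem (E.smul_mem γ hVE) (E.smul_mem K h1))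
      (fun z => by simpa using hdrift z) x
    rw [hPn.map_add _ (E.smul_mem γ hVE) _ (E.smul_mem K h1), hPn.map_smul _ _ hVE,
      hPn.map_const] at hle
    simp only [Pi.add_apply, Pi.smul_apply, Pi.one_apply, smul_eq_mul, mul_one] at hle
    rw [Function.iterate_succ_apply]
    have := mul_le_mul_of_nonneg_left (ih x) hγ0.le
    rw [pow_succ']
    linarith

/-- A lower bound on `B` for all times in a window propagates to sublevel sets of a function
contracted off `B`. -/
lemma le_iterate_of_le_on (hP : IsMarkovOperator E P) {V f : S → ℝ} (hVE : V ∈ E)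
    (hV : ∀ x, 1 ≤ V x) (hf : f ∈ E) (hf0 : 0 ≤ f) {B : Set S} {γ α : ℝ} (hγ0 : 0 < γ)
    (hα : 0 ≤ α) (hB : ∀ x ∉ B, P V x ≤ γ * V x) {M N : ℕ}
    (hle : ∀ b ∈ B, ∀ k, M ≤ k → k ≤ M + N → α ≤ P^[k] f b) (n : ℕ) (hn : n ≤ N) (x : S) :
    α * (1 - γ ^ n * V x) ≤ P^[M + n] f x := by
  have hxB : ∀ n ≤ N, ∀ x ∈ B, α * (1 - γ ^ n * V x) ≤ P^[M + n] f x := fun n hn x hx => by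
    have h0 : 0 ≤ γ ^ n * V x := mul_nonneg (by positivity) (by linarith [hV x])
    have := hle x hx (M + n) (by omega) (by omega)
    nlinarith [mul_nonneg hα h0]
  induction n generalizing x with
  | zero =>
    by_cases hx : x ∈ B
    · exact hxB 0 hn x hx
    · have h1 : 0 ≤ P^[M + 0] f x := (hP.iterate _).map_nonneg f hf hf0 x
      nlinarith [hV x]
  | succ n ih =>
    by_cases hx : x ∈ B
    · exact hxB _ hn x hx
    · have h1 := hP.one_mem
      have hle := hP.mono
        (E.sub_mem (E.smul_mem α h1) (E.smul_mem (α * γ ^ n) hVE))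
        ((hP.iterate (M + n)).map_mem f hf)
        (fun z => by
          have := ih (by omega) z
          simp only [Pi.sub_apply, Pi.smul_apply, Pi.one_apply, smul_eq_mul]
          linarith) x
      rw [hP.map_sub (E.smul_mem α h1) (E.smul_mem (α * γ ^ n) hVE), hP.map_const,
        hP.map_smul _ _ hVE] at hle
      simp only [Pi.sub_apply, Pi.smul_apply, Pi.one_apply, smul_eq_mul] at hle
      rw [← add_assoc, Function.iterate_succ_apply']
      have h2 : α * γ ^ n * P V x ≤ α * γ ^ n * (γ * V x) :=
        mul_le_mul_of_nonneg_left (hB x hx) (by positivity)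
      rw [pow_succ]
      linarith

lemma iterate_pointMass_mul_le (hP : IsMarkovOperator E P) {f : S → ℝ} (hf : f ∈ E) (hf0 : 0 ≤ f)
    {j : S} (hj : pointMass j ∈ E) (n : ℕ) (i : S) :
    P^[n] (pointMass j) i * f j ≤ P^[n] f i := by
  have h := (hP.iterate n).mono (E.smul_mem (f j) hj) hf (fun z => by
    by_cases hz : z = j
    · subst hz; simp [pointMass_apply]
    · simpa [pointMass_apply, hz] using hf0 z) i
  rw [(hP.iterate n).map_smul _ _ hj] at h
  simpa [mul_comm] using h

/-- Geometric decay of the distance of `P^n φ` to the constants. -/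
theorem exists_geometric_const [Nonempty S] (hP : IsMarkovOperator E P) {V : S → ℝ}
    (hVE : V ∈ E) (hV : ∀ x, 1 ≤ V x) {B : Set S} (hBfin : B.Finite) {γ K : ℝ}
    (hγ0 : 0 < γ) (hγ1 : γ < 1) (hK : 0 < K) (hB : ∀ x ∉ B, P V x ≤ γ * V x)
    (hdrift : ∀ x, P V x ≤ γ * V x + K) (j : S) (hj : pointMass j ∈ E)
    (hpos : ∀ b ∈ B, ∃ M, ∀ k, M ≤ k → 0 < P^[k] (pointMass j) b) :
    ∃ β θ A : ℝ, 0 < β ∧ 0 < θ ∧ θ < 1 ∧ ∀ φ ∈ E, (∀ z, |φ z| ≤ 1) →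
      ∀ n, ∃ c, ∀ z, |P^[n] φ z - c| ≤ A * θ ^ n * (1 + β * V z) := by
  have h1γ : 0 < 1 - γ := by linarith
  set C := K / (1 - γ) with hC
  have hC0 : 0 < C := by positivity
  set R := 4 * C / (1 - γ) with hR
  have hR0 : 0 < R := by positivity
  have hj0 : 0 ≤ pointMass j := pointMass_nonneg j
  obtain ⟨N, hN⟩ := exists_pow_lt_of_lt_one (show 0 < 1 / (2 * R) by positivity) hγ1
  obtain ⟨M, hM1, hM⟩ : ∃ M, 1 ≤ M ∧ ∀ b ∈ B, ∀ k, M ≤ k → 0 < P^[k] (pointMass j) b := by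
    choose! F hF using hpos
    obtain ⟨M, hM⟩ := (hBfin.image F).bddAbove
    refine ⟨M + 1, by omega, fun b hb k hk => hF b hb k ?_⟩
    have := hM ⟨b, hb, rfl⟩
    omega
  obtain ⟨α, hα0, hα⟩ : ∃ α : ℝ, 0 < α ∧ ∀ b ∈ B, ∀ k, M ≤ k → k ≤ M + N →
      α ≤ P^[k] (pointMass j) b := by
    have hfin : ((fun q : S × ℕ => P^[q.2] (pointMass j) q.1) ''
        (B ×ˢ Set.Icc M (M + N))).Finite := (hBfin.prod (Set.finite_Icc _ _)).image _
    rcases (hfin.toFinset).eq_empty_or_nonempty with he | hne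
    · refine ⟨1, one_pos, fun b hb k h1 h2 => ?_⟩
      have : P^[k] (pointMass j) b ∈ hfin.toFinset :=
        hfin.mem_toFinset.2 ⟨(b, k), ⟨hb, h1, h2⟩, rfl⟩
      simp [he] at this
    · refine ⟨hfin.toFinset.min' hne, ?_, fun b hb k h1 h2 =>
        Finset.min'_le _ _ (hfin.mem_toFinset.2 ⟨(b, k), ⟨hb, h1, h2⟩, rfl⟩)⟩
      obtain ⟨⟨b, k⟩, ⟨hb, h1, -⟩, hbk⟩ := hfin.mem_toFinset.1 (Finset.min'_mem _ hne)
      rw [← hbk]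
      exact hM b hb k h1
  set m := M + N with hm
  have hm1 : 1 ≤ m := by omega
  have hV0 : (0 : S → ℝ) ≤ V := fun x => zero_le_one.trans (hV x)
  have hiter := hP.iterate_drift hVE hγ0 hγ1 hK.le hdrift
  obtain ⟨β, θ₀, hβ, hθ₀, hθ₀1, hcontr⟩ := (hP.iterate m).exists_contraction hVE hV0 hγ0 hγ1 hC0
    hR0 (show 4 * C ≤ (1 - γ) * R by rw [hR]; field_simp; rfl) (half_pos hα0)
    (fun x => (hiter m x).trans (by
      have : γ ^ m ≤ γ := pow_le_of_le_one hγ0.le hγ1.le (by omega)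
      have := mul_le_mul_of_nonneg_right this (hV0 x)
      linarith)) j
    (fun x hx f hf hf0 => by
      have h1 := hP.le_iterate_of_le_on hVE hV hj hj0 hγ0 hα0.le hB hα N le_rfl x
      have h2 := hP.iterate_pointMass_mul_le hf hf0 hj m x
      have h3 : γ ^ N * V x ≤ 1 / 2 := by
        calc γ ^ N * V x ≤ 1 / (2 * R) * R :=
              mul_le_mul hN.le hx (hV0 x) (by positivity)
          _ = 1 / 2 := by field_simp
      have h4 : α / 2 ≤ P^[m] (pointMass j) x := by
        refine le_trans ?_ h1
        nlinarith
      exact (mul_le_mul_of_nonneg_right h4 (hf0 j)).trans h2)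
  obtain ⟨θ, hθ0, hθ1, hθ⟩ : ∃ θ : ℝ, 0 < θ ∧ θ < 1 ∧ θ ^ m = θ₀ :=
    ⟨θ₀ ^ ((m : ℝ)⁻¹), Real.rpow_pos_of_pos hθ₀ _, Real.rpow_lt_one hθ₀.le hθ₀1 (by positivity),
      Real.rpow_inv_natCast_pow hθ₀.le (by omega)⟩
  refine ⟨β, θ, (1 + β * C) / θ₀, hβ, hθ0, hθ1, fun φ hφ hφ1 n => ?_⟩
  set r := n % m
  set q := n / m
  have hstart : ∀ z, |P^[r] φ z - 0| ≤ (1 + β * C) * (1 + β * V z) := fun z => by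
    have h1 := (hP.iterate r).abs_sub_const_le hVE hφ (M := 1) (β := β) (c := 0)
      (fun z => by
        have := mul_nonneg hβ.le (hV0 z)
        simp only [sub_zero]
        linarith [hφ1 z]) z
    have h2 : γ ^ r ≤ 1 := pow_le_one₀ hγ0.le hγ1.le
    have h3 : β * P^[r] V z ≤ β * (V z + C) := by
      refine mul_le_mul_of_nonneg_left ((hiter r z).trans ?_) hβ.le
      have := mul_le_mul_of_nonneg_right h2 (hV0 z)
      linarith
    have h4 : 0 ≤ β * C * (β * V z) :=
      mul_nonneg (by positivity) (mul_nonneg hβ.le (hV0 z))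
    linarith
  have hskel : ∀ q : ℕ, ∃ c, ∀ z, |(P^[m])^[q] (P^[r] φ) z - c| ≤
      θ₀ ^ q * (1 + β * C) * (1 + β * V z) := by
    intro q
    induction q with
    | zero => exact ⟨0, by simpa using hstart⟩
    | succ q ih =>
      have := hcontr (θ₀ ^ q * (1 + β * C)) (by positivity) _
        (((hP.iterate m).iterate q).map_mem _ ((hP.iterate r).map_mem φ hφ)) ih
      rw [Function.iterate_succ_apply', pow_succ']
      simpa only [mul_assoc] using this
  obtain ⟨c, hc⟩ := hskel q
  refine ⟨c, fun z => ?_⟩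
  have hsplit : P^[n] φ = (P^[m])^[q] (P^[r] φ) := by
    rw [← Function.iterate_mul, ← Function.iterate_add_apply, Nat.div_add_mod]
  rw [hsplit]
  refine (hc z).trans ?_
  have hpow : θ₀ ^ q ≤ θ ^ n / θ₀ := by
    rw [le_div_iff₀ hθ₀, ← hθ, ← pow_mul, ← pow_add]
    refine pow_le_pow_of_le_one hθ0.le hθ1.le ?_
    have h1 : m * q + n % m = n := Nat.div_add_mod n m
    have h2 : n % m < m := Nat.mod_lt n (by omega)
    omega
  calc θ₀ ^ q * (1 + β * C) * (1 + β * V z)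
      ≤ θ ^ n / θ₀ * (1 + β * C) * (1 + β * V z) := by
        have := mul_nonneg hβ.le (hV0 z)
        gcongr
    _ = _ := by ring

/-- Geometric convergence of `P^n φ` to a constant. -/
theorem exists_geometric_limit (hP : IsMarkovOperator E P) {V : S → ℝ}
    (hVE : V ∈ E) {β θ A : ℝ} (hθ1 : θ < 1) {φ : S → ℝ} (hφ : φ ∈ E)
    (h : ∀ n, ∃ c, ∀ z, |P^[n] φ z - c| ≤ A * θ ^ n * (1 + β * V z)) :
    ∃ L : ℝ, ∀ x, ∃ C, ∀ n, |P^[n] φ x - L| ≤ C * θ ^ n := by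
  choose c hc using h
  have hstep : ∀ x n, dist (c n) (c (n + 1)) ≤ A * (2 + β * V x + β * P V x) * θ ^ n := by
    intro x n
    have h1 := hP.abs_sub_const_le hVE ((hP.iterate n).map_mem φ hφ) (hc n) x
    have h2 := hc (n + 1) x
    rw [Function.iterate_succ_apply'] at h2
    have h3 : A * θ ^ (n + 1) * (1 + β * V x) ≤ A * θ ^ n * (1 + β * V x) := by
      have h0 := (abs_nonneg _).trans (hc n x)
      calc _ = θ * (A * θ ^ n * (1 + β * V x)) := by ring
        _ ≤ 1 * (A * θ ^ n * (1 + β * V x)) := mul_le_mul_of_nonneg_right hθ1.le h0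
        _ = _ := one_mul _
    rw [Real.dist_eq, abs_le]
    rw [abs_le] at h1 h2
    constructor <;> nlinarith [h1.1, h1.2, h2.1, h2.2]
  rcases isEmpty_or_nonempty S with _ | ⟨⟨x₀⟩⟩
  · exact ⟨0, fun x => isEmptyElim x⟩
  obtain ⟨L, hL⟩ := cauchySeq_tendsto_of_complete (cauchySeq_of_le_geometric θ _ hθ1 (hstep x₀))
  refine ⟨L, fun x => ⟨A * (1 + β * V x) + A * (2 + β * V x + β * P V x) / (1 - θ), fun n => ?_⟩⟩
  have h1 := dist_le_of_le_geometric_of_tendsto θ _ hθ1 (hstep x) hL n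
  have h2 := hc n x
  rw [← Real.dist_eq] at h2 ⊢
  refine (dist_triangle _ (c n) _).trans ((add_le_add h2 h1).trans (le_of_eq ?_))
  ring

end IsMarkovOperator

/-- The action `f ↦ (i ↦ ∑ j, p i j * f j)` of a nonnegative matrix on functions. -/
noncomputable def transOp {S : Type*} (p : S → S → ℝ) (f : S → ℝ) (i : S) : ℝ :=
  ∑' j, p i j * f j

section Transition

variable {S : Type*} {p : S → S → ℝ}

lemma summable_mul_of_mem_weightedBounded (hp : ∀ i j, 0 ≤ p i j) {W : S → ℝ}
    (hsum : ∀ i, Summable fun j => p i j * W j) {f : S → ℝ} (hf : f ∈ weightedBounded W)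
    (i : S) : Summable fun j => p i j * f j := by
  obtain ⟨C, hC⟩ := hf
  refine Summable.of_norm_bounded ((hsum i).mul_left C) fun j => ?_
  rw [Real.norm_eq_abs, abs_mul, abs_of_nonneg (hp i j)]
  have := mul_le_mul_of_nonneg_left (hC j) (hp i j)
  linarith

lemma isMarkovOperator_transOp (hp : ∀ i j, 0 ≤ p i j) (hrow : ∀ i, HasSum (p i) 1)
    {W : S → ℝ} (hW : ∀ i, 1 ≤ W i) (hsum : ∀ i, Summable fun j => p i j * W j) {K : ℝ}
    (hK : ∀ i, transOp p W i ≤ K * W i) :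
    IsMarkovOperator (weightedBounded W) (transOp p) := by
  have hs := fun f (hf : f ∈ weightedBounded W) =>
    summable_mul_of_mem_weightedBounded hp hsum hf
  refine ⟨mem_weightedBounded_of_abs_le 1 fun i => by simpa using hW i, ?_, ?_, ?_, ?_, ?_⟩
  · intro f hf
    have hsf := hs f hf
    obtain ⟨C, hC⟩ := hf
    refine mem_weightedBounded_of_abs_le (|C| * K) fun i => ?_
    have h1 : |transOp p f i| ≤ |C| * transOp p W i := by
      unfold transOp
      rw [← tsum_mul_left, ← Real.norm_eq_abs]
      refine tsum_of_norm_bounded ((hsum i).mul_left |C|).hasSum fun j => ?_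
      rw [Real.norm_eq_abs, abs_mul, abs_of_nonneg (hp i j)]
      have h2 : |f j| ≤ |C| * W j := (hC j).trans
        (mul_le_mul_of_nonneg_right (le_abs_self C) (zero_le_one.trans (hW j)))
      have := mul_le_mul_of_nonneg_left h2 (hp i j)
      linarith
    refine h1.trans ?_
    have := mul_le_mul_of_nonneg_left (hK i) (abs_nonneg C)
    linarith
  · intro f hf g hg
    funext i
    simp only [transOp, Pi.add_apply, mul_add]
    exact (hs f hf i).tsum_add (hs g hg i)
  · intro c f hf
    funext i
    simp only [transOp, Pi.smul_apply, smul_eq_mul, ← tsum_mul_left]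
    exact tsum_congr fun j => by ring
  · funext i
    simpa [transOp] using (hrow i).tsum_eq
  · exact fun f _ hf0 i => tsum_nonneg fun j => mul_nonneg (hp i j) (hf0 j)

/-- The transition operator on bounded functions. -/
lemma isMarkovOperator_transOp_one (hp : ∀ i j, 0 ≤ p i j) (hrow : ∀ i, HasSum (p i) 1) :
    IsMarkovOperator (weightedBounded (1 : S → ℝ)) (transOp p) :=
  isMarkovOperator_transOp hp hrow (fun _ => le_rfl) (fun i => by simpa using (hrow i).summable)
    (K := 1) fun i => by simp [transOp, (hrow i).tsum_eq]

lemma abs_pointMass_le_one (j i : S) : |pointMass j i| ≤ 1 := by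
  rw [pointMass_apply]; split_ifs <;> simp

lemma pointMass_mem_weightedBounded {W : S → ℝ} (hW : ∀ i, 1 ≤ W i) (j : S) :
    pointMass j ∈ weightedBounded W :=
  mem_weightedBounded_of_abs_le 1 fun i => by
    linarith [abs_pointMass_le_one j i, hW i]

lemma transOp_pointMass (i j : S) : transOp p (pointMass j) i = p i j := by
  simp [transOp, pointMass_apply]

lemma nstep_eq_iterate (n : ℕ) (i j : S) : nstep p n i j = (transOp p)^[n] (pointMass j) i := by
  induction n generalizing i with
  | zero => rfl
  | succ n ih =>
    rw [Function.iterate_succ_apply']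
    cases n with
    | zero => exact (transOp_pointMass i j).symm
    | succ n =>
      have h : nstep p (n + 2) i j =
          ∑' r : ↥((∅ : Set S)ᶜ), p i (r : S) * nstep p (n + 1) (r : S) j := rfl
      rw [h, tsum_subtype ((∅ : Set S)ᶜ) fun r => p i r * nstep p (n + 1) r j]
      simp only [Set.compl_empty, Set.indicator_univ, transOp]
      exact tsum_congr fun r => by rw [ih r]

lemma nstep_nonneg (hp : ∀ i j, 0 ≤ p i j) (hrow : ∀ i, HasSum (p i) 1) (n : ℕ) (i j : S) :
    0 ≤ nstep p n i j := by
  rw [nstep_eq_iterate]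
  exact ((isMarkovOperator_transOp_one hp hrow).iterate n).map_nonneg _
    (pointMass_mem_weightedBounded (fun _ => le_rfl) j) (pointMass_nonneg j) i

lemma nstep_mul_le (hp : ∀ i j, 0 ≤ p i j) (hrow : ∀ i, HasSum (p i) 1) (m n : ℕ) (i j k : S) :
    nstep p m i j * nstep p n j k ≤ nstep p (m + n) i k := by
  have hP := isMarkovOperator_transOp_one hp hrow
  have hpt : ∀ j : S, pointMass j ∈ weightedBounded (1 : S → ℝ) :=
    pointMass_mem_weightedBounded fun _ => le_rfl
  simp only [nstep_eq_iterate]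
  rw [Function.iterate_add_apply]
  exact hP.iterate_pointMass_mul_le ((hP.iterate n).map_mem _ (hpt k))
    ((hP.iterate n).map_nonneg _ (hpt k) (pointMass_nonneg k)) (hpt j) m i

/-- In an irreducible aperiodic chain all large enough step counts have positive probability. -/
lemma exists_forall_ge_nstep_pos (hp : ∀ i j, 0 ≤ p i j) (hrow : ∀ i, HasSum (p i) 1)
    (hirr : ∀ i j, ∃ n, 1 ≤ n ∧ 0 < nstep p n i j)
    (haper : ∀ i, ∀ d : ℕ, (∀ n, 1 ≤ n → 0 < nstep p n i i → d ∣ n) → d = 1) (i j : S) :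
    ∃ M, ∀ k, M ≤ k → 0 < nstep p k i j := by
  set s : AddSubmonoid ℕ :=
    { carrier := {n | 0 < nstep p n j j}
      zero_mem' := by simp [nstep, tabooP]
      add_mem' := fun {a b} ha hb =>
        (mul_pos ha hb).trans_le (nstep_mul_le hp hrow a b j j j) }
  have hgcd : Nat.setGcd (s : Set ℕ) = 1 :=
    haper j _ fun n _ hn => Nat.setGcd_dvd_of_mem hn
  obtain ⟨N, hN⟩ := Nat.exists_mem_closure_of_ge (s : Set ℕ)
  obtain ⟨m, -, hm⟩ := hirr i j
  refine ⟨m + N, fun k hk => ?_⟩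
  obtain ⟨l, rfl⟩ := Nat.exists_eq_add_of_le (show m ≤ k by omega)
  have hl := hN l (by omega) (by rw [hgcd]; exact one_dvd l)
  rw [AddSubmonoid.closure_eq] at hl
  exact (mul_pos hm hl).trans_le (nstep_mul_le hp hrow m l i j j)

section Stationary

variable {π : S → ℝ}

/-- A stationary distribution integrates `P f` and `f` equally, for bounded `f`. -/
lemma hasSum_stationary_mul_transOp (hp : ∀ i j, 0 ≤ p i j) (hrow : ∀ i, HasSum (p i) 1)
    (hπ0 : ∀ j, 0 ≤ π j) (hπ1 : HasSum π 1) (hπ : ∀ j, HasSum (fun i => π i * p i j) (π j))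
    {f : S → ℝ} (hf : f ∈ weightedBounded (1 : S → ℝ)) :
    HasSum (fun i => π i * transOp p f i) (∑' j, π j * f j) := by
  have hsf := summable_mul_of_mem_weightedBounded hp
    (fun i => by simpa using (hrow i).summable) hf
  obtain ⟨C, hC⟩ := hf
  simp only [Pi.one_apply, mul_one] at hC
  have hπp : Summable fun q : S × S => π q.1 * p q.1 q.2 := by
    refine (summable_prod_of_nonneg fun q => mul_nonneg (hπ0 _) (hp _ _)).2
      ⟨fun i => (hrow i).summable.mul_left (π i), ?_⟩
    simpa [tsum_mul_left, (hrow _).tsum_eq] using hπ1.summable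
  have hF : Summable fun q : S × S => π q.1 * p q.1 q.2 * f q.2 := by
    refine Summable.of_norm_bounded (hπp.mul_left C) fun q => ?_
    have h0 := mul_nonneg (hπ0 q.1) (hp q.1 q.2)
    rw [Real.norm_eq_abs, abs_mul, abs_of_nonneg h0, mul_comm C]
    exact mul_le_mul_of_nonneg_left (hC _) h0
  have h1 := hF.hasSum.prod_fiberwise (g := fun i => π i * transOp p f i) fun i => by
    simpa only [mul_assoc, transOp] using (hsf i).hasSum.mul_left (π i)
  have h2 := ((Equiv.prodComm S S).hasSum_iff.2 hF.hasSum).prod_fiberwise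
    (g := fun j => π j * f j) fun j => (hπ j).mul_right (f j)
  rwa [h2.tsum_eq]

lemma hasSum_stationary_mul_iterate (hp : ∀ i j, 0 ≤ p i j) (hrow : ∀ i, HasSum (p i) 1)
    (hπ0 : ∀ j, 0 ≤ π j) (hπ1 : HasSum π 1) (hπ : ∀ j, HasSum (fun i => π i * p i j) (π j))
    (n : ℕ) (j : S) :
    HasSum (fun i => π i * (transOp p)^[n] (pointMass j) i) (π j) := by
  have hP := isMarkovOperator_transOp_one hp hrow
  induction n with
  | zero =>
    convert hasSum_ite_eq j (π j) using 2 with i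
    by_cases h : i = j <;> simp [pointMass_apply, h]
  | succ n ih =>
    simp only [Function.iterate_succ_apply']
    rw [← ih.tsum_eq]
    exact hasSum_stationary_mul_transOp hp hrow hπ0 hπ1 hπ
      ((hP.iterate n).map_mem _ (pointMass_mem_weightedBounded (fun _ => le_rfl) j))

lemma stationary_pos (hp : ∀ i j, 0 ≤ p i j) (hrow : ∀ i, HasSum (p i) 1)
    (hirr : ∀ i j, ∃ n, 1 ≤ n ∧ 0 < nstep p n i j)
    (hπ0 : ∀ j, 0 ≤ π j) (hπ1 : HasSum π 1) (hπ : ∀ j, HasSum (fun i => π i * p i j) (π j))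
    (j : S) : 0 < π j := by
  refine (hπ0 j).lt_of_ne' fun hj => ?_
  have hzero : π = 0 := by
    funext i
    obtain ⟨n, -, hn⟩ := hirr i j
    have h := hasSum_stationary_mul_iterate hp hrow hπ0 hπ1 hπ n j
    simp only [← nstep_eq_iterate] at h
    rw [hj, hasSum_zero_iff_of_nonneg fun i => mul_nonneg (hπ0 i) (nstep_nonneg hp hrow n i j)]
      at h
    exact (mul_eq_zero.1 (congrFun h i)).resolve_right hn.ne'
  rw [hzero] at hπ1
  exact zero_ne_one (hasSum_zero.unique hπ1)

/-- For an irreducible chain with a stationary distribution, a bounded nonnegative subharmonic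
function vanishing somewhere vanishes everywhere. -/
lemma eq_zero_of_subharmonic (hp : ∀ i j, 0 ≤ p i j) (hrow : ∀ i, HasSum (p i) 1)
    (hirr : ∀ i j, ∃ n, 1 ≤ n ∧ 0 < nstep p n i j)
    (hπ0 : ∀ j, 0 ≤ π j) (hπ1 : HasSum π 1) (hπ : ∀ j, HasSum (fun i => π i * p i j) (π j))
    {g : S → ℝ} (hg : g ∈ weightedBounded (1 : S → ℝ)) (hg0 : 0 ≤ g)
    (hsub : ∀ i, g i ≤ transOp p g i) {b : S} (hb : g b = 0) : g = 0 := by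
  have hP := isMarkovOperator_transOp_one hp hrow
  have h1 := hasSum_stationary_mul_transOp hp hrow hπ0 hπ1 hπ hg
  have h2 : HasSum (fun i => π i * g i) (∑' j, π j * g j) := by
    refine Summable.hasSum (Summable.of_nonneg_of_le (fun i => mul_nonneg (hπ0 i) (hg0 i))
      (fun i => ?_) h1.summable)
    exact mul_le_mul_of_nonneg_left (hsub i) (hπ0 i)
  have h3 := h1.sub h2
  rw [sub_self, hasSum_zero_iff_of_nonneg fun i => sub_nonneg.2
    (mul_le_mul_of_nonneg_left (hsub i) (hπ0 i))] at h3
  have hfix : transOp p g = g := by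
    funext i
    have := congrFun h3 i
    simp only [Pi.zero_apply, ← mul_sub] at this
    have := (mul_eq_zero.1 this).resolve_left
      (stationary_pos hp hrow hirr hπ0 hπ1 hπ i).ne'
    linarith
  funext j
  obtain ⟨n, -, hn⟩ := hirr b j
  have h := hP.iterate_pointMass_mul_le hg hg0
    (pointMass_mem_weightedBounded (fun _ => le_rfl) j) n b
  rw [Function.iterate_fixed hfix, hb, ← nstep_eq_iterate] at h
  exact le_antisymm (nonpos_of_mul_nonpos_right h hn) (hg0 j)

end Stationary

end Transition

section Hitting

variable {S : Type*} {p : S → S → ℝ}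

/-- The probability of first hitting `B` at time exactly `n`. -/
noncomputable def hitProb (p : S → S → ℝ) (B : Set S) : ℕ → S → ℝ
  | 0 => fun i => if i ∈ B then 1 else 0
  | n + 1 => fun i => if i ∈ B then 0 else transOp p (hitProb p B n) i

/-- The generating function `∑ n, r ^ n * hitProb p B n i` of the hitting time of `B`. -/
noncomputable def hitGen (p : S → S → ℝ) (B : Set S) (r : ℝ) (i : S) : ℝ :=
  ∑' n, r ^ n * hitProb p B n i

lemma hitProb_nonneg (hp : ∀ i j, 0 ≤ p i j) (B : Set S) (n : ℕ) (i : S) :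
    0 ≤ hitProb p B n i := by
  induction n generalizing i with
  | zero => simp only [hitProb]; split_ifs <;> simp
  | succ n ih =>
    simp only [hitProb]
    split_ifs
    · exact le_rfl
    · exact tsum_nonneg fun j => mul_nonneg (hp i j) (ih j)

lemma sum_hitProb_le_one (hp : ∀ i j, 0 ≤ p i j) (hrow : ∀ i, HasSum (p i) 1) (B : Set S)
    (n : ℕ) (i : S) : ∑ k ∈ Finset.range n, hitProb p B k i ≤ 1 := by
  induction n generalizing i with
  | zero => simp
  | succ n ih =>
    rw [Finset.sum_range_succ']
    by_cases hi : i ∈ B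
    · simp [hitProb, hi]
    · have hle : ∀ k ∈ Finset.range n, ∀ j, hitProb p B k j ≤ 1 := fun k hk j =>
        (Finset.single_le_sum (f := fun k => hitProb p B k j)
          (fun k _ => hitProb_nonneg hp B k j) hk).trans (ih j)
      have hs : ∀ k ∈ Finset.range n, Summable fun j => p i j * hitProb p B k j := fun k hk =>
        Summable.of_nonneg_of_le (fun j => mul_nonneg (hp i j) (hitProb_nonneg hp B k j))
          (fun j => mul_le_of_le_one_right (hp i j) (hle k hk j)) (hrow i).summable
      simp only [hitProb, hi, if_false, add_zero, transOp]
      rw [← Summable.tsum_finsetSum hs, ← (hrow i).tsum_eq]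
      refine Summable.tsum_le_tsum (fun j => ?_) (summable_sum hs) (hrow i).summable
      rw [← Finset.mul_sum]
      exact mul_le_of_le_one_right (hp i j) (ih j)

lemma hitGen_of_mem {B : Set S} {i : S} (hi : i ∈ B) (r : ℝ) : hitGen p B r i = 1 := by
  rw [hitGen, tsum_eq_single 0 fun n hn => ?_]
  · simp [hitProb, hi]
  · obtain ⟨m, rfl⟩ := Nat.exists_eq_succ_of_ne_zero hn
    simp [hitProb, hi]

section WeightedSpectralGap

variable {t : S → ℝ} {B : Set S} {ρ c : ℝ}

lemma hitProb_le (hp : ∀ i j, 0 ≤ p i j) (ht : ∀ i, 0 < t i) (hρ : 0 < ρ)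
    (hsum : ∀ i, Summable fun j => p i j * t j) (hgap : ∀ i ∉ B, transOp p t i ≤ ρ * t i)
    (hc0 : 0 ≤ c) (hc : ∀ b ∈ B, 1 ≤ c * t b) (n : ℕ) (i : S) :
    hitProb p B n i ≤ c * ρ ^ n * t i := by
  have hpos : ∀ n i, 0 ≤ c * ρ ^ n * t i := fun n i =>
    mul_nonneg (by positivity) (ht i).le
  induction n generalizing i with
  | zero =>
    simp only [hitProb]
    split_ifs with h
    · simpa using hc i h
    · exact hpos 0 i
  | succ n ih =>
    simp only [hitProb]
    split_ifs with h
    · exact hpos _ i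
    · have hs := (hsum i).mul_left (c * ρ ^ n)
      have hle : ∀ j, p i j * hitProb p B n j ≤ c * ρ ^ n * (p i j * t j) := fun j => by
        have := mul_le_mul_of_nonneg_left (ih j) (hp i j)
        linarith
      calc transOp p (hitProb p B n) i ≤ ∑' j, c * ρ ^ n * (p i j * t j) :=
            (hs.of_nonneg_of_le (fun j => mul_nonneg (hp i j) (hitProb_nonneg hp B n j))
              hle).tsum_le_tsum hle hs
        _ = c * ρ ^ n * transOp p t i := tsum_mul_left
        _ ≤ c * ρ ^ n * (ρ * t i) := mul_le_mul_of_nonneg_left (hgap i h) (by positivity)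
        _ = _ := by ring

variable {r : ℝ}

lemma pow_mul_hitProb_le (hp : ∀ i j, 0 ≤ p i j) (ht : ∀ i, 0 < t i) (hρ : 0 < ρ)
    (hsum : ∀ i, Summable fun j => p i j * t j) (hgap : ∀ i ∉ B, transOp p t i ≤ ρ * t i)
    (hc0 : 0 ≤ c) (hc : ∀ b ∈ B, 1 ≤ c * t b) (hr : 0 ≤ r) (n : ℕ) (i : S) :
    r ^ n * hitProb p B n i ≤ (r * ρ) ^ n * (c * t i) := by
  have := mul_le_mul_of_nonneg_left (hitProb_le hp ht hρ hsum hgap hc0 hc n i) (pow_nonneg hr n)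
  rw [mul_pow]
  linarith

lemma summable_hitGen (hp : ∀ i j, 0 ≤ p i j) (ht : ∀ i, 0 < t i) (hρ : 0 < ρ)
    (hsum : ∀ i, Summable fun j => p i j * t j) (hgap : ∀ i ∉ B, transOp p t i ≤ ρ * t i)
    (hc0 : 0 ≤ c) (hc : ∀ b ∈ B, 1 ≤ c * t b) (hr : 0 ≤ r) (hrρ : r * ρ < 1) (i : S) :
    Summable fun n => r ^ n * hitProb p B n i :=
  Summable.of_nonneg_of_le (fun n => mul_nonneg (pow_nonneg hr n) (hitProb_nonneg hp B n i))
    (fun n => pow_mul_hitProb_le hp ht hρ hsum hgap hc0 hc hr n i)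
    ((summable_geometric_of_lt_one (by positivity) hrρ).mul_right _)

lemma hitGen_le (hp : ∀ i j, 0 ≤ p i j) (ht : ∀ i, 0 < t i) (hρ : 0 < ρ)
    (hsum : ∀ i, Summable fun j => p i j * t j) (hgap : ∀ i ∉ B, transOp p t i ≤ ρ * t i)
    (hc0 : 0 ≤ c) (hc : ∀ b ∈ B, 1 ≤ c * t b) (hr : 0 ≤ r) (hrρ : r * ρ < 1) (i : S) :
    hitGen p B r i ≤ (1 - r * ρ)⁻¹ * c * t i := by
  have hgeom := summable_geometric_of_lt_one (show 0 ≤ r * ρ by positivity) hrρ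
  rw [mul_assoc, ← tsum_geometric_of_lt_one (show 0 ≤ r * ρ by positivity) hrρ, ← tsum_mul_right]
  exact (summable_hitGen hp ht hρ hsum hgap hc0 hc hr hrρ i).tsum_le_tsum
    (fun n => pow_mul_hitProb_le hp ht hρ hsum hgap hc0 hc hr n i) (hgeom.mul_right _)

lemma hitGen_of_notMem (hp : ∀ i j, 0 ≤ p i j) (ht : ∀ i, 0 < t i) (hρ : 0 < ρ)
    (hsum : ∀ i, Summable fun j => p i j * t j) (hgap : ∀ i ∉ B, transOp p t i ≤ ρ * t i)
    (hc0 : 0 ≤ c) (hc : ∀ b ∈ B, 1 ≤ c * t b) (hr : 0 ≤ r) (hrρ : r * ρ < 1) {i : S}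
    (hi : i ∉ B) : hitGen p B r i = r * transOp p (hitGen p B r) i := by
  have hs := summable_hitGen hp ht hρ hsum hgap hc0 hc hr hrρ
  have hgeom := summable_geometric_of_lt_one (show 0 ≤ r * ρ by positivity) hrρ
  have hprod : Summable fun q : ℕ × S => r ^ q.1 * (p i q.2 * hitProb p B q.1 q.2) := by
    refine Summable.of_nonneg_of_le (fun q => mul_nonneg (pow_nonneg hr _)
      (mul_nonneg (hp _ _) (hitProb_nonneg hp B _ _))) (fun q => ?_)
      ((hgeom.mul_of_nonneg (hsum i) (fun n => by positivity)
        (fun j => mul_nonneg (hp i j) (ht j).le)).mul_left c)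
    have := mul_le_mul_of_nonneg_left
      (pow_mul_hitProb_le hp ht hρ hsum hgap hc0 hc hr q.1 q.2) (hp i q.2)
    linarith
  have hcomm := hprod.tsum_comm (f := fun n j => r ^ n * (p i j * hitProb p B n j))
  rw [hitGen, (hs i).tsum_eq_zero_add]
  simp only [hitProb, hi, if_false, mul_zero, zero_add, pow_succ', mul_assoc, tsum_mul_left]
  congr 1
  simp only [transOp, ← tsum_mul_left]
  rw [← hcomm]
  refine tsum_congr fun j => ?_
  rw [hitGen, ← tsum_mul_left]
  exact tsum_congr fun n => by ring

lemma exists_nonneg_one_le_mul (ht : ∀ i, 0 < t i) (hB : B.Finite) :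
    ∃ c, 0 ≤ c ∧ ∀ b ∈ B, 1 ≤ c * t b := by
  obtain ⟨M, hM⟩ := (hB.image fun b => (t b)⁻¹).bddAbove
  refine ⟨max M 0, le_max_right _ _, fun b hb => ?_⟩
  have h1 : (t b)⁻¹ ≤ max M 0 := (hM ⟨b, hb, rfl⟩).trans (le_max_left _ _)
  rwa [inv_le_iff_one_le_mul₀ (ht b)] at h1

/-- Under the weighted spectral gap condition a positive recurrent irreducible chain hits `B`
almost surely. -/
lemma hitGen_one (hp : ∀ i j, 0 ≤ p i j) (hrow : ∀ i, HasSum (p i) 1)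
    (hirr : ∀ i j, ∃ n, 1 ≤ n ∧ 0 < nstep p n i j) {π : S → ℝ}
    (hπ0 : ∀ j, 0 ≤ π j) (hπ1 : HasSum π 1) (hπ : ∀ j, HasSum (fun i => π i * p i j) (π j))
    (ht : ∀ i, 0 < t i) (hB : B.Nonempty) (hρ : 0 < ρ) (hρ1 : ρ < 1)
    (hsum : ∀ i, Summable fun j => p i j * t j) (hgap : ∀ i ∉ B, transOp p t i ≤ ρ * t i)
    (hc0 : 0 ≤ c) (hc : ∀ b ∈ B, 1 ≤ c * t b) : hitGen p B 1 = 1 := by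
  obtain ⟨b, hb⟩ := hB
  have hs := summable_hitGen hp ht hρ hsum hgap hc0 hc zero_le_one (by simpa using hρ1)
  have hP := isMarkovOperator_transOp_one hp hrow
  have h0 : ∀ i, 0 ≤ hitGen p B 1 i := fun i =>
    tsum_nonneg fun n => mul_nonneg (by simp) (hitProb_nonneg hp B n i)
  have h1 : ∀ i, hitGen p B 1 i ≤ 1 := fun i =>
    (hs i).tsum_le_of_sum_range_le fun n => by simpa using sum_hitProb_le_one hp hrow B n i
  have hmem : hitGen p B 1 ∈ weightedBounded (1 : S → ℝ) :=
    mem_weightedBounded_of_abs_le 1 fun i => by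
      rw [abs_of_nonneg (h0 i)]
      simpa using h1 i
  have hg0 : (0 : S → ℝ) ≤ 1 - hitGen p B 1 := sub_nonneg.2 h1
  have hg := (weightedBounded (1 : S → ℝ)).sub_mem hP.one_mem hmem
  refine (sub_eq_zero.1 (eq_zero_of_subharmonic hp hrow hirr hπ0 hπ1 hπ hg hg0 (fun i => ?_)
    (b := b) (by simp [hitGen_of_mem hb]))).symm
  by_cases hi : i ∈ B
  · simpa [hitGen_of_mem hi] using hP.map_nonneg _ hg hg0 i
  · rw [hP.map_sub hP.one_mem hmem, hP.map_one, Pi.sub_apply, Pi.sub_apply,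
      hitGen_of_notMem hp ht hρ hsum hgap hc0 hc zero_le_one (by simpa using hρ1) hi, one_mul]

/-- The weighted spectral gap condition yields a Lyapunov function bounded below by `1`. -/
lemma exists_lyapunov (hp : ∀ i j, 0 ≤ p i j) (hrow : ∀ i, HasSum (p i) 1)
    (hirr : ∀ i j, ∃ n, 1 ≤ n ∧ 0 < nstep p n i j) {π : S → ℝ}
    (hπ0 : ∀ j, 0 ≤ π j) (hπ1 : HasSum π 1) (hπ : ∀ j, HasSum (fun i => π i * p i j) (π j))
    (ht : ∀ i, 0 < t i) (hBfin : B.Finite) (hB : B.Nonempty) (hρ : 0 < ρ) (hρ1 : ρ < 1)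
    (hsum : ∀ i, Summable fun j => p i j * t j) (hgap : ∀ i ∉ B, transOp p t i ≤ ρ * t i) :
    ∃ (V : S → ℝ) (γ K : ℝ), (∀ i, 1 ≤ V i) ∧ 0 < γ ∧ γ < 1 ∧ 0 < K ∧
      (∀ i, Summable fun j => p i j * V j) ∧ (∀ i ∉ B, transOp p V i ≤ γ * V i) ∧
      ∀ i, transOp p V i ≤ γ * V i + K := by
  obtain ⟨c, hc0, hc⟩ := exists_nonneg_one_le_mul ht hBfin
  set γ := (1 + ρ) / 2 with hγ
  have hγ0 : 0 < γ := by positivity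
  have hγ1 : γ < 1 := by linarith
  have hr : 0 ≤ γ⁻¹ := by positivity
  have hr1 : 1 ≤ γ⁻¹ := (one_le_inv₀ hγ0).2 hγ1.le
  have hrρ : γ⁻¹ * ρ < 1 := by
    rw [inv_mul_lt_iff₀ hγ0]
    linarith
  have hV1 : ∀ i, 1 ≤ hitGen p B γ⁻¹ i := fun i => by
    have h := congrFun (hitGen_one hp hrow hirr hπ0 hπ1 hπ ht hB hρ hρ1 hsum hgap hc0 hc) i
    rw [Pi.one_apply] at h
    rw [← h]
    refine (summable_hitGen hp ht hρ hsum hgap hc0 hc zero_le_one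
      (by simpa using hρ1) i).tsum_le_tsum (fun n => ?_)
      (summable_hitGen hp ht hρ hsum hgap hc0 hc hr hrρ i)
    exact mul_le_mul_of_nonneg_right (pow_le_pow_left₀ zero_le_one hr1 n)
      (hitProb_nonneg hp B n i)
  have hoff : ∀ i ∉ B, transOp p (hitGen p B γ⁻¹) i = γ * hitGen p B γ⁻¹ i := fun i hi => by
    rw [hitGen_of_notMem hp ht hρ hsum hgap hc0 hc hr hrρ hi, mul_inv_cancel_left₀ hγ0.ne']
  obtain ⟨K, hK⟩ := (hBfin.image (transOp p (hitGen p B γ⁻¹))).bddAbove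
  refine ⟨hitGen p B γ⁻¹, γ, max K 1, hV1, hγ0, hγ1, by positivity, fun i => ?_,
    fun i hi => (hoff i hi).le, fun i => ?_⟩
  · refine Summable.of_nonneg_of_le
      (fun j => mul_nonneg (hp i j) (zero_le_one.trans (hV1 j))) (fun j => ?_)
      ((hsum i).mul_left ((1 - γ⁻¹ * ρ)⁻¹ * c))
    have := mul_le_mul_of_nonneg_left
      (hitGen_le hp ht hρ hsum hgap hc0 hc hr hrρ j) (hp i j)
    linarith
  · have hV0 : 0 ≤ γ * hitGen p B γ⁻¹ i := mul_nonneg hγ0.le (zero_le_one.trans (hV1 i))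
    by_cases hi : i ∈ B
    · have := (hK ⟨i, hi, rfl⟩).trans (le_max_left K 1)
      linarith
    · rw [hoff i hi]
      have := le_max_right K 1
      linarith

end WeightedSpectralGap

end Hitting

/-- Geometric ergodicity under the weighted spectral gap condition. -/
theorem exists_geometric_rate {S : Type*} {p : S → S → ℝ} (hp : ∀ i j, 0 ≤ p i j)
    (hrow : ∀ i, HasSum (p i) 1) (hirr : ∀ i j, ∃ n, 1 ≤ n ∧ 0 < nstep p n i j)
    (haper : ∀ i, ∀ d : ℕ, (∀ n, 1 ≤ n → 0 < nstep p n i i → d ∣ n) → d = 1) {π : S → ℝ}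
    (hπ0 : ∀ j, 0 ≤ π j) (hπ1 : HasSum π 1) (hπ : ∀ j, HasSum (fun i => π i * p i j) (π j))
    {t : S → ℝ} (ht : ∀ i, 0 < t i) {B : Set S} (hBfin : B.Finite) (hB : B.Nonempty)
    {ρ : ℝ} (hρ : 0 < ρ) (hρ1 : ρ < 1) (hsum : ∀ i, Summable fun j => p i j * t j)
    (hgap : ∀ i ∉ B, transOp p t i ≤ ρ * t i) :
    ∃ θ : ℝ, 0 < θ ∧ θ < 1 ∧ ∀ i j, ∃ C, ∀ n, |nstep p n i j - π j| ≤ C * θ ^ n := by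
  obtain ⟨V, γ, K, hV, hγ0, hγ1, hK, hsumV, hoff, hdrift⟩ :=
    exists_lyapunov hp hrow hirr hπ0 hπ1 hπ ht hBfin hB hρ hρ1 hsum hgap
  have hP := isMarkovOperator_transOp hp hrow hV hsumV (K := γ + K) fun i => by
    nlinarith [hdrift i, hV i]
  have hpt := pointMass_mem_weightedBounded hV
  have hVE : V ∈ weightedBounded V := mem_weightedBounded_of_abs_le 1 fun i => by
    rw [abs_of_nonneg (zero_le_one.trans (hV i)), one_mul]
  obtain ⟨j₀, -⟩ := hB
  have : Nonempty S := ⟨j₀⟩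
  obtain ⟨β, θ, A, -, hθ0, hθ1, hgeom⟩ := hP.exists_geometric_const hVE hV hBfin hγ0 hγ1 hK hoff
    hdrift j₀ (hpt j₀) fun b _ => by
      simpa only [nstep_eq_iterate] using exists_forall_ge_nstep_pos hp hrow hirr haper b j₀
  refine ⟨θ, hθ0, hθ1, fun i j => ?_⟩
  obtain ⟨L, hL⟩ := hP.exists_geometric_limit hVE hθ1 (hpt j)
    (hgeom (pointMass j) (hpt j) (abs_pointMass_le_one j))
  have hlim : ∀ i, Filter.Tendsto (fun n => nstep p n i j) Filter.atTop (nhds L) := fun i => by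
    obtain ⟨C, hC⟩ := hL i
    rw [tendsto_iff_dist_tendsto_zero]
    refine squeeze_zero (fun _ => dist_nonneg) (fun n => ?_)
      (by simpa using (tendsto_pow_atTop_nhds_zero_of_lt_one hθ0.le hθ1).const_mul C)
    rw [Real.dist_eq, nstep_eq_iterate]
    exact hC n
  have hLπ : L = π j := by
    have h1 := tendsto_tsum_of_dominated_convergence (f := fun n i => π i * nstep p n i j)
      hπ1.summable (fun i => (hlim i).const_mul (π i)) (Filter.Eventually.of_forall fun n i => by
        have hle : nstep p n i j ≤ 1 := by
          have := ((hP.iterate n).mono (hpt j) hP.one_mem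
            (fun z => (le_abs_self _).trans (abs_pointMass_le_one j z))) i
          rwa [(hP.iterate n).map_one, ← nstep_eq_iterate] at this
        rw [Real.norm_eq_abs, abs_of_nonneg (mul_nonneg (hπ0 i) (nstep_nonneg hp hrow n i j))]
        exact mul_le_of_le_one_right (hπ0 i) hle)
    rw [tsum_mul_right, hπ1.tsum_eq, one_mul] at h1
    refine tendsto_nhds_unique h1 ?_
    simp only [nstep_eq_iterate,
      (hasSum_stationary_mul_iterate hp hrow hπ0 hπ1 hπ _ j).tsum_eq, tendsto_const_nhds]
  obtain ⟨C, hC⟩ := hL i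
  exact ⟨C, fun n => by simpa only [nstep_eq_iterate, ← hLπ] using hC n⟩

section Words

variable {S : Type*} {p : S → S → ℝ}

lemma chainWeight_nonneg (hp : ∀ i j, 0 ≤ p i j) (x : S) (l : List S) :
    0 ≤ chainWeight p x l := by
  induction l generalizing x with
  | nil => exact zero_le_one
  | cons y l ih => exact mul_nonneg (hp x y) (ih y)

lemma chainWeight_append (x : S) (l w : List S) :
    chainWeight p x (l ++ w) = chainWeight p x l * chainWeight p (l.getLastD x) w := by
  induction l generalizing x with
  | nil => simp [chainWeight]
  | cons y l ih =>
    rw [List.cons_append, chainWeight, chainWeight, ih, List.getLastD_cons, mul_assoc]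

/-- Prepending a letter to a word of length `m`. -/
def consEquiv (S : Type*) (m : ℕ) :
    S × {l : List S // l.length = m} ≃ {l : List S // l.length = m + 1} where
  toFun q := ⟨q.1 :: q.2, by simp [q.2.2]⟩
  invFun
    | ⟨[], h⟩ => absurd h (by simp)
    | ⟨x :: l, h⟩ => (x, ⟨l, by simpa using h⟩)
  left_inv _ := rfl
  right_inv
    | ⟨[], h⟩ => absurd h (by simp)
    | ⟨_ :: _, _⟩ => rfl

/-- Summing the weights of all bridges of length `m` gives the `(m + 1)`-step transition
probability. -/
lemma hasSum_chainWeight_append_cons (hp : ∀ i j, 0 ≤ p i j) (hrow : ∀ i, HasSum (p i) 1)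
    (y : S) (w : List S) (m : ℕ) (x : S) :
    HasSum (fun c : {l : List S // l.length = m} => chainWeight p x ((c : List S) ++ y :: w))
      (nstep p (m + 1) x y * chainWeight p y w) := by
  induction m generalizing x with
  | zero =>
    have : Unique {l : List S // l.length = 0} :=
      ⟨⟨⟨[], rfl⟩⟩, fun l => Subtype.ext (List.length_eq_zero_iff.1 l.2)⟩
    have hc : ∀ c : {l : List S // l.length = 0}, chainWeight p x ((c : List S) ++ y :: w) =
        nstep p (0 + 1) x y * chainWeight p y w := fun c => by
      simp [List.length_eq_zero_iff.1 c.2, chainWeight, nstep, tabooP]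
    rw [← hc default]
    exact hasSum_unique _
  | succ m ih =>
    have hP := isMarkovOperator_transOp_one hp hrow
    have hmem := (hP.iterate (m + 1)).map_mem _ (pointMass_mem_weightedBounded (fun _ => le_rfl) y)
    have hs := summable_mul_of_mem_weightedBounded hp
      (fun i => by simpa using (hrow i).summable) hmem x
    have houter : HasSum (fun z => p x z * (nstep p (m + 1) z y * chainWeight p y w))
        (nstep p (m + 1 + 1) x y * chainWeight p y w) := by
      simp only [nstep_eq_iterate, ← mul_assoc]
      rw [Function.iterate_succ_apply' _ (m + 1)]
      exact hs.hasSum.mul_right _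
    rw [← (consEquiv S m).hasSum_iff]
    have hinner : ∀ z, HasSum (fun c : {l : List S // l.length = m} =>
        chainWeight p x ((consEquiv S m (z, c) : List S) ++ y :: w))
        (p x z * (nstep p (m + 1) z y * chainWeight p y w)) := fun z =>
      (ih z).mul_left (p x z)
    have hsum : Summable fun q : S × {l : List S // l.length = m} =>
        chainWeight p x ((consEquiv S m q : List S) ++ y :: w) := by
      refine (summable_prod_of_nonneg fun q => chainWeight_nonneg hp _ _).2
        ⟨fun z => (hinner z).summable, ?_⟩
      simpa only [(hinner _).tsum_eq] using houter.summable
    have := hsum.hasSum.prod_fiberwise hinner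
    rw [houter.unique this]
    exact hsum.hasSum

end Words

end CountableMarkov

/-- Symbolic-dynamics form of the paper's main theorem (Theorem 4.5 via Proposition 3.2):
exponential decay of correlations of cylinder sets for the shift-invariant Markov measure,
under the weighted spectral gap condition. -/
theorem stmt_1 {S : Type*} [Countable S] (p : S → S → ℝ)
    (hp_nonneg : ∀ i j, 0 ≤ p i j)
    (hp_row : ∀ i, HasSum (fun j => p i j) 1)
    (hirr : ∀ i j, ∃ n, 1 ≤ n ∧ 0 < nstep p n i j)
    (haper : ∀ i, ∀ d : ℕ, (∀ n, 1 ≤ n → 0 < nstep p n i i → d ∣ n) → d = 1)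
    (π : S → ℝ) (hπ_nonneg : ∀ j, 0 ≤ π j) (hπ_sum : HasSum π 1)
    (hπ_stat : ∀ j, HasSum (fun i => π i * p i j) (π j))
    (t : S → ℝ) (ht : ∀ i, 0 < t i)
    (B : Set S) (hBfin : B.Finite) (hBne : B.Nonempty)
    (ρ : ℝ) (hρ0 : 0 < ρ) (hρ1 : ρ < 1)
    (hsum : ∀ i, Summable fun j => p i j * t j)
    (hWSG : ∀ i ∉ B, ∑' j, p i j * t j ≤ ρ * t i) :
    ∃ θ : ℝ, 0 < θ ∧ θ < 1 ∧
      ∀ a b : List S, a ≠ [] → b ≠ [] →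
        ∃ C : ℝ, 0 < C ∧ ∀ n : ℕ, a.length ≤ n →
          |(∑' c : {l : List S // l.length = n - a.length},
              wordWeight p π (a ++ (c : List S) ++ b)) -
            wordWeight p π a * wordWeight p π b| ≤ C * θ ^ n := by
  obtain ⟨θ, hθ0, hθ1, hrate⟩ := CountableMarkov.exists_geometric_rate hp_nonneg hp_row hirr haper
    hπ_nonneg hπ_sum hπ_stat ht hBfin hBne hρ0 hρ1 hsum hWSG
  refine ⟨θ, hθ0, hθ1, fun a b ha hb => ?_⟩
  obtain ⟨x, a, rfl⟩ := List.exists_cons_of_ne_nil ha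
  obtain ⟨y, b, rfl⟩ := List.exists_cons_of_ne_nil hb
  obtain ⟨C, hC⟩ := hrate (a.getLastD x) y
  have hC0 : 0 ≤ C := by simpa using (abs_nonneg _).trans (hC 0)
  set u := wordWeight p π (x :: a)
  have hu0 : 0 ≤ u := mul_nonneg (hπ_nonneg x) (CountableMarkov.chainWeight_nonneg hp_nonneg x a)
  set v := chainWeight p y b
  have hv0 : 0 ≤ v := CountableMarkov.chainWeight_nonneg hp_nonneg y b
  refine ⟨u * v * C / θ ^ (x :: a).length + 1, by positivity, fun n hn => ?_⟩
  set m := n - (x :: a).length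
  have hsplit : ∀ c : {l : List S // l.length = m},
      wordWeight p π (x :: a ++ (c : List S) ++ y :: b) =
        u * chainWeight p (a.getLastD x) ((c : List S) ++ y :: b) := fun c => by
    rw [List.append_assoc, List.cons_append, wordWeight, CountableMarkov.chainWeight_append,
      ← mul_assoc]
    rfl
  simp only [hsplit]
  rw [((CountableMarkov.hasSum_chainWeight_append_cons hp_nonneg hp_row y b m
    (a.getLastD x)).mul_left u).tsum_eq]
  calc |u * (nstep p (m + 1) (a.getLastD x) y * v) - u * wordWeight p π (y :: b)|
      = u * v * |nstep p (m + 1) (a.getLastD x) y - π y| := by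
        rw [show wordWeight p π (y :: b) = π y * v from rfl]
        rw [show u * (nstep p (m + 1) (a.getLastD x) y * v) - u * (π y * v) =
          u * v * (nstep p (m + 1) (a.getLastD x) y - π y) by ring, abs_mul,
          abs_of_nonneg (mul_nonneg hu0 hv0)]
    _ ≤ u * v * (C * θ ^ m) := by
        refine mul_le_mul_of_nonneg_left ((hC (m + 1)).trans ?_) (mul_nonneg hu0 hv0)
        exact mul_le_mul_of_nonneg_left (pow_le_pow_of_le_one hθ0.le hθ1.le (by omega)) hC0
    _ = u * v * C / θ ^ (x :: a).length * θ ^ n := by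
        rw [show n = m + (x :: a).length by omega, pow_add]
        field_simp
    _ ≤ _ := mul_le_mul_of_nonneg_right (by linarith) (by positivity)
end

section
/- Let p be a stochastic matrix on a countable set S, let t : S → (0,∞), let B ⊆ S be finite and nonempty, and let ρ ∈ (0,1) be such that Σ_{j∈S} p(i,j)·t_j ≤ ρ·t_i for every i ∈ S∖B. Set M = max_{j∈B} t_j^{−1}. Then for every i ∈ S∖B and every n ≥ 1, the probability of first entering B at time n while avoiding B before, namely Σ_{j∈B} p^{(n),B}_{ij}, is at most M·t_i·ρ^n. (Lemma 4.2, second assertion.) -/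
open scoped Classical

theorem tabooP_succ_mem_Icc {S : Type*} {p : S → S → ℝ}
    (hp_nonneg : ∀ i j, 0 ≤ p i j) (hp_row : ∀ i, HasSum (fun j => p i j) 1)
    (B : Set S) (n : ℕ) (i j : S) : tabooP p B (n + 1) i j ∈ Set.Icc (0 : ℝ) 1 := by
  induction n generalizing i with
  | zero => exact ⟨hp_nonneg i j, le_hasSum (hp_row i) j fun k _ => hp_nonneg i k⟩
  | succ n ih =>
    have hnonneg (r : ↥Bᶜ) : 0 ≤ p i r * tabooP p B (n + 1) r j :=
      mul_nonneg (hp_nonneg i r) (ih r).1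
    have hle (r : ↥Bᶜ) : p i r * tabooP p B (n + 1) r j ≤ p i r :=
      mul_le_of_le_one_right (hp_nonneg i r) (ih r).2
    have hsub : Summable fun r : ↥Bᶜ => p i r := (hp_row i).summable.subtype Bᶜ
    refine ⟨tsum_nonneg hnonneg, ?_⟩
    calc ∑' r : ↥Bᶜ, p i r * tabooP p B (n + 1) r j
        ≤ ∑' r : ↥Bᶜ, p i r := (hsub.of_nonneg_of_le hnonneg hle).tsum_le_tsum hle hsub
      _ ≤ ∑' r, p i r := (hp_row i).summable.tsum_subtype_le _ _ (hp_nonneg i)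
      _ = 1 := (hp_row i).tsum_eq

theorem summable_mul_tabooP_succ {S : Type*} {p : S → S → ℝ}
    (hp_nonneg : ∀ i j, 0 ≤ p i j) (hp_row : ∀ i, HasSum (fun j => p i j) 1)
    (B : Set S) (n : ℕ) (i j : S) :
    Summable fun r : ↥Bᶜ => p i r * tabooP p B (n + 1) r j :=
  ((hp_row i).summable.subtype Bᶜ).of_nonneg_of_le
    (fun r => mul_nonneg (hp_nonneg i r) (tabooP_succ_mem_Icc hp_nonneg hp_row B n r j).1)
    (fun r => mul_le_of_le_one_right (hp_nonneg i r)
      (tabooP_succ_mem_Icc hp_nonneg hp_row B n r j).2)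

/-- Lemma 4.2, second assertion: under the weighted spectral gap condition with data
`(t, B, ρ)` (with `B` finite and nonempty), the probability of first entering `B` at time `n`
while avoiding `B` before is at most `M t_i ρ^n`, where `M = max_{j ∈ B} t_j⁻¹`. -/
theorem stmt_3 {S : Type*} [Countable S] (p : S → S → ℝ)
    (hp_nonneg : ∀ i j, 0 ≤ p i j)
    (hp_row : ∀ i, HasSum (fun j => p i j) 1)
    (t : S → ℝ) (ht : ∀ i, 0 < t i)
    (B : Finset S) (hBne : B.Nonempty)
    (ρ : ℝ) (hρ0 : 0 < ρ) (hρ1 : ρ < 1)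
    (hsum : ∀ i ∉ B, Summable fun j => p i j * t j)
    (hWSG : ∀ i ∉ B, ∑' j, p i j * t j ≤ ρ * t i) :
    ∀ i ∉ B, ∀ n : ℕ, 1 ≤ n →
      (∑ j ∈ B, tabooP p (↑B : Set S) n i j) ≤
        (B.sup' hBne fun j => (t j)⁻¹) * t i * ρ ^ n := by
  set M := B.sup' hBne fun j => (t j)⁻¹
  have hMle (j : S) (hj : j ∈ B) : (t j)⁻¹ ≤ M := Finset.le_sup' (fun j => (t j)⁻¹) hj
  have hM0 : 0 ≤ M := by
    obtain ⟨j, hj⟩ := hBne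
    exact (inv_pos.2 (ht j)).le.trans (hMle j hj)
  have hpt (i j : S) : 0 ≤ p i j * t j := mul_nonneg (hp_nonneg i j) (ht j).le
  intro i hi n hn
  induction n, hn using Nat.le_induction generalizing i with
  | base =>
    calc ∑ j ∈ B, p i j ≤ ∑ j ∈ B, M * (p i j * t j) := by
          refine Finset.sum_le_sum fun j hj => ?_
          have h : 1 ≤ M * t j := (inv_le_iff_one_le_mul₀ (ht j)).1 (hMle j hj)
          calc p i j ≤ p i j * (M * t j) := le_mul_of_one_le_right (hp_nonneg i j) h
            _ = M * (p i j * t j) := by ring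
      _ = M * ∑ j ∈ B, p i j * t j := (Finset.mul_sum ..).symm
      _ ≤ M * (ρ * t i) := by
          gcongr
          exact ((hsum i hi).sum_le_tsum B fun j _ => hpt i j).trans (hWSG i hi)
      _ = M * t i * ρ ^ 1 := by ring
  | succ n hn ih =>
    obtain ⟨m, rfl⟩ := Nat.exists_eq_add_of_le' hn
    have hsummable (j : S) := summable_mul_tabooP_succ hp_nonneg hp_row (↑B : Set S) m i j
    have hle (r : ↥(↑B : Set S)ᶜ) :
        ∑ j ∈ B, p i r * tabooP p (↑B : Set S) (m + 1) r j ≤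
          M * ρ ^ (m + 1) * (p i r * t r) := by
      rw [← Finset.mul_sum]
      calc p i r * ∑ j ∈ B, tabooP p (↑B : Set S) (m + 1) r j
          ≤ p i r * (M * t r * ρ ^ (m + 1)) :=
            mul_le_mul_of_nonneg_left (ih r fun h => r.2 h) (hp_nonneg i r)
        _ = M * ρ ^ (m + 1) * (p i r * t r) := by ring
    calc ∑ j ∈ B, ∑' r : ↥(↑B : Set S)ᶜ, p i r * tabooP p (↑B : Set S) (m + 1) r j
        = ∑' r : ↥(↑B : Set S)ᶜ, ∑ j ∈ B, p i r * tabooP p (↑B : Set S) (m + 1) r j :=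
          (Summable.tsum_finsetSum fun j _ => hsummable j).symm
      _ ≤ ∑' r : ↥(↑B : Set S)ᶜ, M * ρ ^ (m + 1) * (p i r * t r) :=
          (summable_sum fun j _ => hsummable j).tsum_le_tsum hle
            (((hsum i hi).subtype _).mul_left _)
      _ = M * ρ ^ (m + 1) * ∑' r : ↥(↑B : Set S)ᶜ, p i r * t r := tsum_mul_left
      _ ≤ M * ρ ^ (m + 1) * (ρ * t i) := by
          gcongr
          exact ((hsum i hi).tsum_subtype_le _ _ (hpt i)).trans (hWSG i hi)
      _ = M * t i * ρ ^ (m + 1 + 1) := by ring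
end
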